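/- arXiv:2001.01239 — 2 statements merged into one kernel-verified Lean document; each statement's English description precedes it below -/
import Mathlib

section
/- Let p > 1 and 0 < γ < 1. Then the solution u(·,γ) exists on all of [0,∞), satisfies u(s,γ) ≥ γ for all s ≥ 0, the function s ↦ u(s,γ) − 1 has infinitely many zeros in (0,∞), and u(·,γ) has infinitely many positive critical points. -/
open Real Set Filter Topology MeasureTheory

noncomputable section

/-- The nonlinearity `f(u) = -u + u^p`. -/
def fNL (p u : ℝ) : ℝ := -u + u ^ p

/-- The Sobolev critical exponent `p_S = (N+2)/(N-2)`. -/
def pSob (N : ℕ) : ℝ := ((N : ℝ) + 2) / ((N : ℝ) - 2)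

/-- `θ = 2/(p-1)`. -/
def thetaP (p : ℝ) : ℝ := 2 / (p - 1)

/-- `A = (θ(N-2-θ))^{1/(p-1)}`. -/
def Aconst (N : ℕ) (p : ℝ) : ℝ :=
  (thetaP p * ((N : ℝ) - 2 - thetaP p)) ^ (1 / (p - 1))

/-- `m = (θ(N-2-θ))^{-1/2}`. -/
def mConst (N : ℕ) (p : ℝ) : ℝ :=
  (thetaP p * ((N : ℝ) - 2 - thetaP p)) ^ (-(1 / 2) : ℝ)

/-- `α = m(N-2-2θ)`. -/
def alphaConst (N : ℕ) (p : ℝ) : ℝ :=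
  mConst N p * ((N : ℝ) - 2 - 2 * thetaP p)

/-- The condition `p < p_JL`, where `p_JL = 1 + 4/(N-4-2√(N-1))` for `N ≥ 11` and
`p_JL = ∞` for `N ≤ 10`. -/
def pJLcond (N : ℕ) (p : ℝ) : Prop :=
  11 ≤ N → p < 1 + 4 / ((N : ℝ) - 4 - 2 * Real.sqrt ((N : ℝ) - 1))

/-- `y` is a C² solution of `y'' + α y' - y + y^p - m² e^{2mt} y = 0` on `(-∞, T]`
with `y → 1` as `t → -∞`; `y'`, `y''` are its first and second derivatives. -/
def IsSingODEOn (N : ℕ) (p T : ℝ) (y y' y'' : ℝ → ℝ) : Prop :=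
  (∀ t ∈ Iic T, HasDerivWithinAt y (y' t) (Iic T) t) ∧
  (∀ t ∈ Iic T, HasDerivWithinAt y' (y'' t) (Iic T) t) ∧
  ContinuousOn y'' (Iic T) ∧
  (∀ t ∈ Iic T, y'' t + alphaConst N p * y' t - y t + y t ^ p
      - (mConst N p) ^ 2 * Real.exp (2 * mConst N p * t) * y t = 0) ∧
  Tendsto y atBot (𝓝 1)

/-- `y` is a C² solution of `y'' + α y' - y + y^p - m² e^{2mt} y = 0` on all of `ℝ`
with `y → 1` as `t → -∞`. -/
def IsEntireSingODE (N : ℕ) (p : ℝ) (y y' y'' : ℝ → ℝ) : Prop :=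
  (∀ t : ℝ, HasDerivAt y (y' t) t) ∧
  (∀ t : ℝ, HasDerivAt y' (y'' t) t) ∧
  Continuous y'' ∧
  (∀ t : ℝ, y'' t + alphaConst N p * y' t - y t + y t ^ p
      - (mConst N p) ^ 2 * Real.exp (2 * mConst N p * t) * y t = 0) ∧
  Tendsto y atBot (𝓝 1)

/-- The singular solution `u*(s) = A s^{-θ} y*(m⁻¹ log s)` built from `y*`. -/
def ustar (N : ℕ) (p : ℝ) (y : ℝ → ℝ) (s : ℝ) : ℝ :=
  Aconst N p * s ^ (-(thetaP p)) * y (Real.log s / mConst N p)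

/-- `u` is a C² solution on `[0,∞)` of the IVP `u'' + ((N-1)/s)u' + f(u) = 0`,
`u(0) = γ`, `u'(0) = 0`, with nonlinearity `f(u) = -u + u^p`. -/
def IsIVPSol (N : ℕ) (p γ : ℝ) (u u' u'' : ℝ → ℝ) : Prop :=
  (∀ s ∈ Ici (0:ℝ), HasDerivWithinAt u (u' s) (Ici 0) s) ∧
  (∀ s ∈ Ici (0:ℝ), HasDerivWithinAt u' (u'' s) (Ici 0) s) ∧
  ContinuousOn u'' (Ici 0) ∧
  u 0 = γ ∧ u' 0 = 0 ∧
  (∀ s > (0:ℝ), u'' s + ((N : ℝ) - 1) / s * u' s + fNL p (u s) = 0)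

/-- `u` is a C² solution on `[0,∞)` of the IVP `u'' + ((N-1)/ρ)u' + u^p = 0`,
`u(0) = γ`, `u'(0) = 0`. -/
def IsBarSol (N : ℕ) (p γ : ℝ) (u u' u'' : ℝ → ℝ) : Prop :=
  (∀ ρ ∈ Ici (0:ℝ), HasDerivWithinAt u (u' ρ) (Ici 0) ρ) ∧
  (∀ ρ ∈ Ici (0:ℝ), HasDerivWithinAt u' (u'' ρ) (Ici 0) ρ) ∧
  ContinuousOn u'' (Ici 0) ∧
  u 0 = γ ∧ u' 0 = 0 ∧
  (∀ ρ > (0:ℝ), u'' ρ + ((N : ℝ) - 1) / ρ * u' ρ + u ρ ^ p = 0)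

/-- `s` is the `(k+1)`-th positive critical point of a function whose derivative is `u'`:
`s` is a positive critical point having exactly `k` positive critical points below it. -/
def IsNthCritPt (u' : ℝ → ℝ) (k : ℕ) (s : ℝ) : Prop :=
  0 < s ∧ u' s = 0 ∧ {x : ℝ | 0 < x ∧ x < s ∧ u' x = 0}.encard = (k : ℕ∞)

/-- `U` is a positive C² radial solution of the Neumann problem
`U'' + ((N-1)/r)U' + λ f(U) = 0` on `(0,1)`, `U'(0) = U'(1) = 0`, `U > 0` on `[0,1]`. -/
def NeumannSol (N : ℕ) (p lam : ℝ) (U U' U'' : ℝ → ℝ) : Prop :=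
  (∀ r ∈ Icc (0:ℝ) 1, HasDerivWithinAt U (U' r) (Icc 0 1) r) ∧
  (∀ r ∈ Icc (0:ℝ) 1, HasDerivWithinAt U' (U'' r) (Icc 0 1) r) ∧
  ContinuousOn U'' (Icc 0 1) ∧
  (∀ r ∈ Ioo (0:ℝ) 1, U'' r + ((N : ℝ) - 1) / r * U' r + lam * fNL p (U r) = 0) ∧
  U' 0 = 0 ∧ U' 1 = 0 ∧ (∀ r ∈ Icc (0:ℝ) 1, 0 < U r)

/-- `(lam, U)` is a singular solution of the Neumann problem whose graph meets `1`
exactly `n` times: `U` is C² on `(0,1)`, continuous on `(0,1]`, `U'(1) = 0`, it solves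
`U'' + ((N-1)/r)U' + λ f(U) = 0` on `(0,1)`, satisfies the asymptotics
`U(r) = A(√λ r)^{-θ}(1+o(1))` as `r ↓ 0` (i.e. `r^θ U(r) → A λ^{-θ/2}`),
`U - 1` has exactly `n` zeros in `(0,1]`, and `U > 0` on `(0,1]`. -/
def SingBVPSol (N : ℕ) (p lam : ℝ) (n : ℕ) (U U' U'' : ℝ → ℝ) : Prop :=
  (∀ r ∈ Ioc (0:ℝ) 1, HasDerivWithinAt U (U' r) (Ioc 0 1) r) ∧
  (∀ r ∈ Ioo (0:ℝ) 1, HasDerivAt U' (U'' r) r) ∧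
  ContinuousOn U (Ioc 0 1) ∧
  ContinuousOn U'' (Ioo 0 1) ∧
  (∀ r ∈ Ioo (0:ℝ) 1, U'' r + ((N : ℝ) - 1) / r * U' r + lam * fNL p (U r) = 0) ∧
  U' 1 = 0 ∧
  Tendsto (fun r => r ^ thetaP p * U r) (𝓝[>] (0:ℝ))
    (𝓝 (Aconst N p * lam ^ (-(thetaP p) / 2))) ∧
  {r ∈ Ioc (0:ℝ) 1 | U r = 1}.encard = (n : ℕ∞) ∧
  (∀ r ∈ Ioc (0:ℝ) 1, 0 < U r)

/-- The mean `∫₀¹ σⁿ h(tσ) dσ`, which for `t > 0` equals `t^{-(n+1)} ∫₀ᵗ rⁿ h(r) dr`. -/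
def radialMean (n : ℕ) (h : ℝ → ℝ) (t : ℝ) : ℝ :=
  ∫ σ in (0 : ℝ)..1, σ ^ n * h (t * σ)

lemma continuous_radialMean (n : ℕ) {h : ℝ → ℝ} (hh : Continuous h) :
    Continuous (radialMean n h) := by
  unfold radialMean
  apply intervalIntegral.continuous_parametric_intervalIntegral_of_continuous'
  fun_prop

lemma radialMean_zero (n : ℕ) (h : ℝ → ℝ) : radialMean n h 0 = h 0 / (n + 1) := by
  simp [radialMean, integral_pow, div_eq_inv_mul]

lemma pow_mul_radialMean (n : ℕ) (h : ℝ → ℝ) (t : ℝ) :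
    t ^ (n + 1) * radialMean n h t = ∫ r in (0 : ℝ)..t, r ^ n * h r := by
  have key := intervalIntegral.mul_integral_comp_mul_left
    (a := 0) (b := 1) (f := fun r => r ^ n * h r) t
  simp only [mul_zero, mul_one] at key
  rw [← key, radialMean, pow_succ', mul_assoc, ← intervalIntegral.integral_const_mul]
  congr 2
  ext σ
  ring

lemma radialMean_sub (n : ℕ) {h k : ℝ → ℝ} (hh : Continuous h) (hk : Continuous k) (t : ℝ) :
    radialMean n (fun r => h r - k r) t = radialMean n h t - radialMean n k t := by
  unfold radialMean
  rw [← intervalIntegral.integral_sub]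
  · simp only [mul_sub]
  · exact Continuous.intervalIntegrable (by fun_prop) _ _
  · exact Continuous.intervalIntegrable (by fun_prop) _ _

lemma hasDerivAt_mul_radialMean (n : ℕ) {h : ℝ → ℝ} (hh : Continuous h) (t : ℝ) :
    HasDerivAt (fun x => x * radialMean n h x) (h t - n * radialMean n h t) t := by
  rcases eq_or_ne t 0 with rfl | ht
  · have hval : h 0 - n * radialMean n h 0 = radialMean n h 0 := by
      rw [radialMean_zero]
      field_simp
      ring
    rw [hval, hasDerivAt_iff_tendsto_slope]
    refine (((continuous_radialMean n hh).tendsto 0).mono_left nhdsWithin_le_nhds).congr' ?_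
    filter_upwards [self_mem_nhdsWithin] with x hx
    have hx0 : x ≠ 0 := hx
    simp [slope_def_field, hx0]
  · have hprim : HasDerivAt (fun x => ∫ r in (0 : ℝ)..x, r ^ n * h r) (t ^ n * h t) t :=
      
      (Continuous.integral_hasStrictDerivAt (by fun_prop) 0 t).hasDerivAt
    have hq := hprim.div (hasDerivAt_pow n t) (pow_ne_zero n ht)
    have heq : (fun x => x * radialMean n h x) =ᶠ[𝓝 t]
        fun x => (∫ r in (0 : ℝ)..x, r ^ n * h r) / x ^ n := by
      filter_upwards [isOpen_ne.mem_nhds ht] with x hx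
      have hx0 : x ≠ 0 := hx
      rw [← pow_mul_radialMean]
      field_simp
      ring
    refine (hq.congr_of_eventuallyEq heq).congr_deriv ?_
    rw [← pow_mul_radialMean]
    rcases n with _ | n
    · simp
    · simp only [Nat.add_sub_cancel]
      field_simp
      ring

lemma abs_mul_radialMean_le (n : ℕ) {h : ℝ → ℝ} {C l : ℝ} (hl : 0 < l)
    (hC : ∀ r, 0 ≤ r → |h r| ≤ C * exp (l * r)) {t : ℝ} (ht : 0 ≤ t) :
    |t * radialMean n h t| ≤ C / l * exp (l * t) := by
  have hC0 : 0 ≤ C := by simpa using (abs_nonneg _).trans (hC 0 le_rfl)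
  have hmean : |radialMean n h t| ≤ ∫ σ in (0 : ℝ)..1, C * exp (l * (t * σ)) := by
    rw [← Real.norm_eq_abs]
    refine intervalIntegral.norm_integral_le_of_norm_le zero_le_one ?_
      (Continuous.intervalIntegrable (by fun_prop) _ _)
    refine Eventually.of_forall fun σ hσ => ?_
    rw [norm_mul, Real.norm_eq_abs, Real.norm_eq_abs, abs_of_nonneg (pow_nonneg hσ.1.le n)]
    calc σ ^ n * |h (t * σ)| ≤ 1 * |h (t * σ)| := by
          gcongr
          exact pow_le_one₀ hσ.1.le hσ.2
      _ ≤ _ := by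
          rw [one_mul]
          exact hC _ (mul_nonneg ht hσ.1.le)
  have hexp : t * ∫ σ in (0 : ℝ)..1, C * exp (l * (t * σ)) = C / l * (exp (l * t) - 1) := by
    have key := intervalIntegral.mul_integral_comp_mul_left
      (a := 0) (b := 1) (f := fun r => C * exp (l * r)) t
    rw [key, intervalIntegral.integral_const_mul,
      intervalIntegral.integral_comp_mul_left (f := exp) hl.ne']
    simp
    ring
  rw [abs_mul, abs_of_nonneg ht]
  calc t * |radialMean n h t| ≤ t * ∫ σ in (0 : ℝ)..1, C * exp (l * (t * σ)) := by gcongr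
    _ = C / l * (exp (l * t) - 1) := hexp
    _ ≤ C / l * exp (l * t) := by gcongr; linarith

lemma abs_integral_mul_radialMean_le (n : ℕ) {h : ℝ → ℝ} {C l : ℝ} (hl : 0 < l)
    (hC : ∀ r, 0 ≤ r → |h r| ≤ C * exp (l * r)) {s : ℝ} (hs : 0 ≤ s) :
    |∫ t in (0 : ℝ)..s, t * radialMean n h t| ≤ C / l ^ 2 * exp (l * s) := by
  have hC0 : 0 ≤ C := by simpa using (abs_nonneg _).trans (hC 0 le_rfl)
  rw [← Real.norm_eq_abs]
  calc ‖∫ t in (0 : ℝ)..s, t * radialMean n h t‖ ≤ ∫ t in (0 : ℝ)..s, C / l * exp (l * t) := by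
        refine intervalIntegral.norm_integral_le_of_norm_le hs ?_
          (Continuous.intervalIntegrable (by fun_prop) _ _)
        exact Eventually.of_forall fun t ht => abs_mul_radialMean_le n hl hC ht.1.le
    _ = C / l ^ 2 * (exp (l * s) - 1) := by
        rw [intervalIntegral.integral_const_mul,
          intervalIntegral.integral_comp_mul_left (f := exp) hl.ne']
        simp
        ring
    _ ≤ C / l ^ 2 * exp (l * s) := by gcongr; linarith

/-- Global solvability of the integral form of `u'' + (n/s) u' + g(u) = 0`, `u(0) = γ`,
`u'(0) = 0`, for a bounded and globally Lipschitz nonlinearity. -/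
lemma exists_radial_integral_solution (n : ℕ) (γ : ℝ) {g : ℝ → ℝ} {K : NNReal} {B : ℝ}
    (hg : LipschitzWith K g) (hB : ∀ x, |g x| ≤ B) :
    ∃ u h : ℝ → ℝ, Continuous h ∧ (∀ s, 0 ≤ s → h s = g (u s)) ∧
      ∀ s, u s = γ - ∫ t in (0 : ℝ)..s, t * radialMean n h t := by
  have hB0 : 0 ≤ B := (abs_nonneg _).trans (hB 0)
  set l : ℝ := K + 1 with hl_def
  have hl : 0 < l := by positivity
  let H : (BoundedContinuousFunction ℝ ℝ) → ℝ → ℝ := fun w r => g (exp (l * r) * w r)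
  have hH : ∀ w, Continuous (H w) := fun w => hg.continuous.comp (by fun_prop)
  have hHm : ∀ w, Continuous fun t => t * radialMean n (H w) t := fun w =>
    continuous_id.mul (continuous_radialMean n (hH w))
  let Φ : (BoundedContinuousFunction ℝ ℝ) → ℝ → ℝ := fun w s =>
    exp (-(l * max s 0)) * (γ - ∫ t in (0 : ℝ)..max s 0, t * radialMean n (H w) t)
  have hΦc : ∀ w, Continuous (Φ w) := fun w => by
    have : Continuous fun s => ∫ t in (0 : ℝ)..s, t * radialMean n (H w) t :=
      intervalIntegral.continuous_primitive (fun a b => (hHm w).intervalIntegrable a b) 0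
    have h2 := this.comp (continuous_id.max (continuous_const (y := (0 : ℝ))))
    exact Continuous.mul (by fun_prop) (continuous_const.sub h2)
  have hΦb : ∀ w s, ‖Φ w s‖ ≤ |γ| + B / l ^ 2 := fun w s => by
    have hs : 0 ≤ max s 0 := le_max_right _ _
    have hI := abs_integral_mul_radialMean_le n (h := H w) (C := B) hl (fun r hr =>
      (hB _).trans (le_mul_of_one_le_right hB0 (one_le_exp (by positivity)))) hs
    have he : (1 : ℝ) ≤ exp (l * max s 0) := one_le_exp (by positivity)
    simp only [Φ]
    rw [norm_mul, Real.norm_eq_abs, Real.norm_eq_abs, abs_exp, exp_neg, inv_mul_le_iff₀ (exp_pos _)]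
    calc |γ - ∫ t in (0 : ℝ)..max s 0, t * radialMean n (H w) t|
        ≤ |γ| + |∫ t in (0 : ℝ)..max s 0, t * radialMean n (H w) t| := abs_sub _ _
      _ ≤ exp (l * max s 0) * |γ| + B / l ^ 2 * exp (l * max s 0) :=
          add_le_add (le_mul_of_one_le_left (abs_nonneg _) he) hI
      _ = _ := by ring
  let T : BoundedContinuousFunction ℝ ℝ → BoundedContinuousFunction ℝ ℝ := fun w =>
    BoundedContinuousFunction.ofNormedAddCommGroup (Φ w) (hΦc w) _ (hΦb w)
  have hT : ContractingWith (K / (K + 1) ^ 2) T := by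
    constructor
    · rw [div_lt_one (by positivity), ← NNReal.coe_lt_coe]
      push_cast
      nlinarith [K.coe_nonneg]
    · refine LipschitzWith.of_dist_le_mul fun w₁ w₂ => ?_
      rw [BoundedContinuousFunction.dist_le (by positivity)]
      intro s
      have hs : 0 ≤ max s 0 := le_max_right _ _
      have hI := abs_integral_mul_radialMean_le n (h := fun r => H w₁ r - H w₂ r)
        (C := K * dist w₁ w₂) hl (fun r hr => by
          have h1 := hg.dist_le_mul (exp (l * r) * w₁ r) (exp (l * r) * w₂ r)
          rw [Real.dist_eq, Real.dist_eq, ← mul_sub, abs_mul, abs_exp] at h1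
          have h2 := BoundedContinuousFunction.dist_coe_le_dist (f := w₁) (g := w₂) r
          rw [Real.dist_eq] at h2
          calc |H w₁ r - H w₂ r| ≤ K * (exp (l * r) * |w₁ r - w₂ r|) := h1
            _ ≤ K * (exp (l * r) * dist w₁ w₂) := by gcongr
            _ = _ := by ring) hs
      have hsub : (∫ t in (0 : ℝ)..max s 0, t * radialMean n (fun r => H w₁ r - H w₂ r) t) =
          (∫ t in (0 : ℝ)..max s 0, t * radialMean n (H w₁) t) -
            ∫ t in (0 : ℝ)..max s 0, t * radialMean n (H w₂) t := by
        rw [← intervalIntegral.integral_sub ((hHm w₁).intervalIntegrable _ _)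
          ((hHm w₂).intervalIntegrable _ _)]
        simp only [radialMean_sub n (hH w₁) (hH w₂), mul_sub]
      rw [hsub] at hI
      change dist (Φ w₁ s) (Φ w₂ s) ≤ _
      simp only [Φ]
      rw [Real.dist_eq, ← mul_sub, abs_mul, abs_exp, exp_neg, inv_mul_le_iff₀ (exp_pos _),
        sub_sub_sub_cancel_left, abs_sub_comm]
      refine hI.trans (le_of_eq ?_)
      push_cast
      rw [← hl_def]
      ring
  obtain ⟨w, hw⟩ : ∃ w, T w = w := ⟨_, hT.fixedPoint_isFixedPt⟩
  refine ⟨fun s => γ - ∫ t in (0 : ℝ)..s, t * radialMean n (H w) t, H w, hH w, ?_, fun s => rfl⟩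
  intro s hs
  have hws : w s = Φ w s := (DFunLike.congr_fun hw s).symm
  simp only [Φ, max_eq_left hs] at hws
  change g (exp (l * s) * w s) = _
  rw [hws, ← mul_assoc, ← exp_add, add_neg_cancel, exp_zero, one_mul]

/-- Oscillation of `v'' + (n/s) v' + q v = 0` when `q` is bounded below by a positive constant. -/
lemma exists_gt_eq_zero_of_radial_ode {n c : ℝ} (hc : 0 < c) {v v' v'' q : ℝ → ℝ}
    (hv : ∀ s, 0 < s → HasDerivAt v (v' s) s) (hv' : ∀ s, 0 < s → HasDerivAt v' (v'' s) s)
    (hode : ∀ s, 0 < s → v'' s + n / s * v' s + q s * v s = 0)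
    (hq : ∀ s, 0 < s → v s ≠ 0 → c ≤ q s) (S : ℝ) : ∃ s, S < s ∧ 0 < s ∧ v s = 0 := by
  by_contra! hne
  set a : ℝ := max S 0 + 1 + |n| / √c with ha
  have haS : S < a := by
    have : S ≤ max S 0 := le_max_left _ _
    have : 0 ≤ |n| / √c := by positivity
    linarith
  have ha0 : 0 < a := by positivity
  have han : |n| / √c ≤ a := by
    have : 0 ≤ max S 0 := le_max_right _ _
    linarith
  set k : ℝ := min c 1 / 2 with hk
  have hk0 : 0 < k := by positivity
  -- the Riccati variable
  set y : ℝ → ℝ := fun s => -v' s / v s with hy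
  have hyd : ∀ s, a ≤ s → HasDerivAt y (q s + y s ^ 2 - n / s * y s) s := by
    intro s hs
    have hs0 : 0 < s := ha0.trans_le hs
    have hvs := hne s (haS.trans_le hs) hs0
    refine ((hv' s hs0).neg.div (hv s hs0) hvs).congr_deriv ?_
    have h2 : v'' s = -(n / s * v' s + q s * v s) := by linarith [hode s hs0]
    simp only [hy, Pi.neg_apply]
    rw [h2]
    field_simp
    ring
  have hmono : ∀ s, a ≤ s → k ≤ 1 / (1 + y s ^ 2) * (q s + y s ^ 2 - n / s * y s) := by
    intro s hs
    have hs0 : 0 < s := ha0.trans_le hs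
    have hqs := hq s hs0 (hne s (haS.trans_le hs) hs0)
    have hns : (n / s) ^ 2 ≤ c := by
      have h1 : |n| ≤ s * √c := by
        rw [← div_le_iff₀ (sqrt_pos.2 hc)]
        exact han.trans hs
      rw [div_pow, div_le_iff₀ (by positivity), ← sq_abs]
      calc |n| ^ 2 ≤ (s * √c) ^ 2 := by gcongr
        _ = c * s ^ 2 := by rw [mul_pow, sq_sqrt hc.le]; ring
    rw [one_div, inv_mul_eq_div, le_div_iff₀ (by positivity)]
    have hkc : k ≤ c / 2 := by rw [hk]; gcongr; exact min_le_left _ _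
    have hk1 : k ≤ 1 / 2 := by rw [hk]; gcongr; exact min_le_right _ _
    nlinarith [sq_nonneg (y s - n / s), sq_nonneg (y s)]
  set b : ℝ := a + π / k with hb
  have hab : a < b := by
    have : 0 < π / k := by positivity
    linarith
  obtain ⟨ξ, hξ, hslope⟩ := exists_hasDerivAt_eq_slope (fun s => arctan (y s)) _ hab
    (fun s hs => ((hyd s hs.1).arctan).continuousAt.continuousWithinAt)
    (fun s hs => (hyd s hs.1.le).arctan)
  have h1 := hmono ξ hξ.1.le
  rw [hslope, le_div_iff₀ (by linarith)] at h1
  have h2 : k * (b - a) = π := by rw [hb]; field_simp; ring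
  linarith [arctan_lt_pi_div_two (y b), neg_pi_div_two_lt_arctan (y a)]

lemma infinite_of_forall_exists_gt_pos {P : ℝ → Prop}
    (h : ∀ S, ∃ s, S < s ∧ 0 < s ∧ P s) : {s : ℝ | 0 < s ∧ P s}.Infinite :=
  Set.infinite_of_forall_exists_gt fun S => by
    obtain ⟨s, hS, hs, hP⟩ := h S
    exact ⟨s, ⟨hs, hP⟩, hS⟩

lemma fNL_continuous {p : ℝ} (hp : 1 < p) : Continuous (fNL p) := by
  unfold fNL
  exact continuous_neg.add (continuous_id.rpow_const fun _ => Or.inr (by linarith))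

lemma fNL_neg {p x : ℝ} (hp : 1 < p) (hx0 : 0 < x) (hx1 : x < 1) : fNL p x < 0 := by
  have := rpow_lt_rpow_of_exponent_gt hx0 hx1 hp
  rw [rpow_one] at this
  unfold fNL
  linarith

lemma fNL_pos {p x : ℝ} (hp : 1 < p) (hx : 1 < x) : 0 < fNL p x := by
  have := rpow_lt_rpow_of_exponent_lt hx hp
  rw [rpow_one] at this
  unfold fNL
  linarith

/-- The secant slope of `f` through its zero `1` is increasing. -/
lemma fNL_secant_le {p x y : ℝ} (hp : 1 < p) (hx0 : 0 < x) (hx1 : x < 1) (hxy : x ≤ y)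
    (hy : y ≠ 1) : fNL p x / (x - 1) ≤ fNL p y / (y - 1) := by
  have hconv : ConvexOn ℝ (Ici 0) (fNL p) :=
    ((concaveOn_id (convex_Ici 0)).neg).add (convexOn_rpow hp.le)
  have h1 : fNL p 1 = 0 := by simp [fNL]
  have := hconv.secant_mono (a := 1) (x := x) (y := y) (by simp) hx0.le (hx0.le.trans hxy)
    hx1.ne hy hxy
  simpa [h1] using this

lemma fNL_lipschitzOnWith {p a b : ℝ} (hp : 1 < p) :
    ∃ K, LipschitzOnWith K (fNL p) (Icc a b) := by
  have hd : ∀ x, HasDerivAt (fNL p) (-1 + p * x ^ (p - 1)) x := fun x =>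
    (hasDerivAt_id x).neg.add (hasDerivAt_rpow_const (Or.inr hp.le))
  have hcont : ContinuousOn (fun x : ℝ => -1 + p * x ^ (p - 1)) (Icc a b) :=
    (continuous_const.add (continuous_const.mul
      (continuous_id.rpow_const fun _ => Or.inr (by linarith)))).continuousOn
  obtain ⟨C, hC⟩ := isCompact_Icc.exists_bound_of_continuousOn hcont
  refine ⟨C.toNNReal, (convex_Icc a b).lipschitzOnWith_of_nnnorm_hasDerivWithin_le
    (fun x _ => (hd x).hasDerivWithinAt) fun x hx => ?_⟩
  rw [← NNReal.coe_le_coe, coe_nnnorm]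
  exact (hC x hx).trans (le_coe_toNNReal C)

lemma integral_fNL {p : ℝ} (hp : 1 < p) (a b : ℝ) :
    ∫ x in a..b, fNL p x =
      (-(b ^ 2 / 2) + b ^ (p + 1) / (p + 1)) - (-(a ^ 2 / 2) + a ^ (p + 1) / (p + 1)) := by
  refine intervalIntegral.integral_eq_sub_of_hasDerivAt
    (f := fun x => -(x ^ 2 / 2) + x ^ (p + 1) / (p + 1)) (fun x _ => ?_)
    ((fNL_continuous hp).intervalIntegrable _ _)
  refine ((((hasDerivAt_pow 2 x).div_const 2).neg).add
    ((hasDerivAt_rpow_const (p := p + 1) (Or.inr (by linarith))).div_const (p + 1))).congr_deriv ?_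
  have : p + 1 ≠ 0 := by linarith
  simp only [fNL, add_sub_cancel_right]
  field_simp
  norm_num
  ring

/-- The potential of `f` climbs back above its value at `γ ∈ (0,1)`. -/
lemma exists_integral_fNL_pos {p γ : ℝ} (hp : 1 < p) (hγ0 : 0 < γ) (hγ1 : γ < 1) :
    ∃ M, 1 < M ∧ 0 < ∫ x in γ..M, fNL p x := by
  set M : ℝ := ((p + 1) / 2) ^ (1 / (p - 1)) with hM
  have hp1 : 0 < p - 1 := by linarith
  have hM1 : 1 < M := one_lt_rpow (by linarith) (by positivity)
  refine ⟨M, hM1, ?_⟩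
  have hM0 : 0 < M := by linarith
  have hMp : M ^ (p - 1) = (p + 1) / 2 := by
    rw [hM, ← rpow_mul (by linarith), one_div_mul_cancel hp1.ne', rpow_one]
  have hMp' : M ^ (p + 1) = (p + 1) / 2 * M ^ 2 := by
    rw [← hMp, ← rpow_natCast, ← rpow_add hM0]
    congr 1
    push_cast
    ring
  have hγp : γ ^ (p + 1) ≤ γ ^ 2 := by
    rw [← rpow_natCast]
    exact rpow_le_rpow_of_exponent_ge hγ0 hγ1.le (by push_cast; linarith)
  have hγp' : γ ^ (p + 1) / (p + 1) < γ ^ 2 / 2 := by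
    rw [div_lt_div_iff₀ (by linarith) (by norm_num)]
    nlinarith [pow_pos hγ0 2]
  rw [integral_fNL hp, hMp']
  have : (p + 1) / 2 * M ^ 2 / (p + 1) = M ^ 2 / 2 := by
    have : p + 1 ≠ 0 := by linarith
    field_simp
  linarith

/-- Points where the potential of the truncated nonlinearity is nonpositive lie in the
truncation interval. -/
lemma mem_Icc_of_integral_clamp_nonpos {f : ℝ → ℝ} {a b x : ℝ} (hf : Continuous f) (hab : a ≤ b)
    (ha : f a < 0) (hb : 0 < f b) (hpot : 0 < ∫ z in a..b, f z)
    (hx : ∫ z in a..x, f (projIcc a b hab z) ≤ 0) : x ∈ Icc a b := by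
  have hg : Continuous fun z => f (projIcc a b hab z) :=
    hf.comp (continuous_subtype_val.comp continuous_projIcc)
  constructor
  · by_contra! hxa
    have : ∫ z in a..x, f (projIcc a b hab z) = ∫ z in a..x, f a := by
      refine intervalIntegral.integral_congr fun z hz => ?_
      rw [uIcc_of_ge hxa.le] at hz
      simp only [projIcc_of_le_left hab hz.2]
    rw [this, intervalIntegral.integral_const, smul_eq_mul] at hx
    nlinarith
  · by_contra! hbx
    have h1 : ∫ z in a..b, f (projIcc a b hab z) = ∫ z in a..b, f z := by
      refine intervalIntegral.integral_congr fun z hz => ?_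
      rw [uIcc_of_le hab] at hz
      simp only [projIcc_of_mem hab hz]
    have h2 : ∫ z in b..x, f (projIcc a b hab z) = ∫ z in b..x, f b := by
      refine intervalIntegral.integral_congr fun z hz => ?_
      rw [uIcc_of_le hbx.le] at hz
      simp only [projIcc_of_right_le hab hz.1]
    rw [← intervalIntegral.integral_add_adjacent_intervals (hg.intervalIntegrable a b)
      (hg.intervalIntegrable b x), h1, h2, intervalIntegral.integral_const, smul_eq_mul] at hx
    nlinarith

/-- for `p > 1` and `0 < γ < 1`, the solution `u(·,γ)` exists on
`[0,∞)`, is bounded below by `γ`, and `u - 1` has infinitely many zeros; in particular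
there are infinitely many positive critical points. -/
theorem ivp_solution_oscillates_below_one (N : ℕ) (hN : 3 ≤ N) (p : ℝ) (hp : 1 < p)
    (γ : ℝ) (hγ0 : 0 < γ) (hγ1 : γ < 1) :
    ∃ u u' u'' : ℝ → ℝ, IsIVPSol N p γ u u' u'' ∧
      (∀ s ≥ (0:ℝ), γ ≤ u s) ∧
      {s : ℝ | 0 < s ∧ u s = 1}.Infinite ∧
      {s : ℝ | 0 < s ∧ u' s = 0}.Infinite := by
  obtain ⟨n, rfl⟩ : ∃ n, N = n + 1 := ⟨N - 1, by omega⟩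
  obtain ⟨M, hM1, hpot⟩ := exists_integral_fNL_pos hp hγ0 hγ1
  have hγM : γ ≤ M := by linarith
  set g : ℝ → ℝ := fun x => fNL p (projIcc γ M hγM x) with hg_def
  have hgc : Continuous g :=
    (fNL_continuous hp).comp (continuous_subtype_val.comp continuous_projIcc)
  obtain ⟨K, hK⟩ := fNL_lipschitzOnWith (a := γ) (b := M) hp
  have hgL : LipschitzWith (K * 1) g :=
    hK.to_restrict.comp (LipschitzWith.projIcc hγM)
  obtain ⟨B, hB⟩ := isCompact_Icc.exists_bound_of_continuousOn
    ((fNL_continuous hp).continuousOn (s := Icc γ M))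
  obtain ⟨u, h, hh, hhg, hu⟩ := exists_radial_integral_solution n γ hgL
    (B := B) fun x => hB _ (projIcc γ M hγM x).2
  have hd : ∀ s, HasDerivAt u (-(s * radialMean n h s)) s := fun s => by
    rw [show u = _ from funext hu]
    have hc : Continuous fun t => t * radialMean n h t :=
      continuous_id.mul (continuous_radialMean n hh)
    exact (hc.integral_hasStrictDerivAt 0 s).hasDerivAt.const_sub γ
  have hd' : ∀ s, HasDerivAt (fun s => -(s * radialMean n h s))
      (-(h s - n * radialMean n h s)) s := fun s => (hasDerivAt_mul_radialMean n hh s).neg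
  have hu0 : u 0 = γ := by simp [hu 0]
  -- the energy is nonincreasing
  have henergy : ∀ s, 0 ≤ s → (s * radialMean n h s) ^ 2 / 2 + ∫ z in γ..u s, g z ≤ 0 := by
    have hE : ∀ s, HasDerivAt
        (fun s => (-(s * radialMean n h s)) ^ 2 / 2 + ∫ z in γ..u s, g z)
        (-(s * radialMean n h s) * (-(h s - n * radialMean n h s))
          + g (u s) * -(s * radialMean n h s)) s := fun s => by
      refine ((((hd' s).pow 2).div_const 2).add
        ((hgc.integral_hasStrictDerivAt γ (u s)).hasDerivAt.comp s (hd s))).congr_deriv ?_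
      simp
      ring
    have hanti : AntitoneOn
        (fun s => (-(s * radialMean n h s)) ^ 2 / 2 + ∫ z in γ..u s, g z) (Ici 0) := by
      refine antitoneOn_of_deriv_nonpos (convex_Ici 0)
        (fun s _ => (hE s).continuousAt.continuousWithinAt)
        (fun s _ => (hE s).differentiableAt.differentiableWithinAt) fun s hs => ?_
      rw [interior_Ici] at hs
      have hs0 : 0 < s := hs
      rw [(hE s).deriv, hhg s hs0.le]
      have : 0 ≤ n * s * radialMean n h s ^ 2 := by positivity
      linarith
    intro s hs
    simpa [hu0] using hanti (mem_Ici.2 le_rfl) (mem_Ici.2 hs) hs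
  have hmem : ∀ s, 0 ≤ s → u s ∈ Icc γ M := fun s hs =>
    mem_Icc_of_integral_clamp_nonpos (fNL_continuous hp) hγM (fNL_neg hp hγ0 hγ1)
      (fNL_pos hp hM1) hpot (by linarith [henergy s hs, sq_nonneg (s * radialMean n h s)])
  have hhf : ∀ s, 0 ≤ s → h s = fNL p (u s) := fun s hs => by
    rw [hhg s hs, hg_def]
    simp only [projIcc_of_mem hγM (hmem s hs)]
  have hode : ∀ s, 0 < s → -(h s - n * radialMean n h s) +
      n / s * -(s * radialMean n h s) + fNL p (u s) = 0 := fun s hs => by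
    rw [hhf s hs.le]
    field_simp
    ring
  have hzero : ∀ S, ∃ s, S < s ∧ 0 < s ∧ u s = 1 := by
    intro S
    obtain ⟨s, hS, hs, hus⟩ := exists_gt_eq_zero_of_radial_ode (n := n)
      (c := fNL p γ / (γ - 1)) (v := fun s => u s - 1)
      (q := fun s => fNL p (u s) / (u s - 1))
      (div_pos_of_neg_of_neg (fNL_neg hp hγ0 hγ1) (by linarith))
      (fun s _ => (hd s).sub_const 1) (fun s _ => hd' s)
      (fun s hs => by
        rcases eq_or_ne (u s) 1 with h1 | h1
        · have := hode s hs
          have h2 : fNL p 1 = 0 := by simp [fNL]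
          rw [h1, h2] at this
          simpa [h1] using this
        · rw [div_mul_cancel₀ _ (sub_ne_zero.2 h1)]
          exact hode s hs)
      (fun s hs hne => fNL_secant_le hp hγ0 hγ1 (hmem s hs.le).1 (sub_ne_zero.1 hne)) S
    exact ⟨s, hS, hs, sub_eq_zero.1 hus⟩
  refine ⟨u, _, _, ⟨fun s _ => (hd s).hasDerivWithinAt, fun s _ => (hd' s).hasDerivWithinAt,
    ?_, hu0, by simp, fun s hs => ?_⟩, fun s hs => (hmem s hs).1,
    infinite_of_forall_exists_gt_pos hzero, infinite_of_forall_exists_gt_pos fun S => ?_⟩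
  · exact (hh.sub (continuous_const.mul (continuous_radialMean n hh))).neg.continuousOn
  · push_cast
    rw [add_sub_cancel_right]
    exact hode s hs
  · obtain ⟨a, hSa, ha, hua⟩ := hzero S
    obtain ⟨b, hab, -, hub⟩ := hzero a
    obtain ⟨c, hc, hc0⟩ := exists_hasDerivAt_eq_zero hab
      (fun s _ => (hd s).continuousAt.continuousWithinAt) (hua.trans hub.symm)
      (fun s _ => hd s)
    exact ⟨c, hSa.trans hc.1, ha.trans hc.1, hc0⟩
end
end

section
/- Suppose p > p_S. Then for every compact interval [a,b] ⊂ (0,∞), sup_{s ∈ [a,b]} ( |u(s,γ) − u*(s)| + |u'(s,γ) − (u*)'(s)| + |u''(s,γ) − (u*)''(s)| ) → 0 as γ → ∞; that is, u(·,γ) together with its first and second derivatives converges to u* uniformly on compact subsets of (0,∞). -/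
open Real Set Filter Topology MeasureTheory

noncomputable section

/-- Grönwall's inequality in differential form. -/
lemma le_mul_exp_of_deriv_le {Z Z' : ℝ → ℝ} {k a b : ℝ} (hab : a ≤ b)
    (hZ : ∀ t ∈ Icc a b, HasDerivAt Z (Z' t) t) (hle : ∀ t ∈ Icc a b, Z' t ≤ k * Z t) :
    Z b ≤ Z a * exp (k * (b - a)) := by
  have hd : ∀ t ∈ Icc a b, HasDerivAt (fun t => Z t * exp (-k * t))
      (Z' t * exp (-k * t) + Z t * (exp (-k * t) * (-k * 1))) t := fun t ht =>
    (hZ t ht).mul (((hasDerivAt_id t).const_mul (-k)).exp)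
  have hanti : AntitoneOn (fun t => Z t * exp (-k * t)) (Icc a b) := by
    apply antitoneOn_of_deriv_nonpos (convex_Icc a b)
    · exact fun t ht => (hd t ht).continuousAt.continuousWithinAt
    · exact fun t ht => (hd t (interior_subset ht)).differentiableAt.differentiableWithinAt
    · intro t ht
      rw [(hd t (interior_subset ht)).deriv]
      have h1 := hle t (interior_subset ht)
      have h2 := exp_pos (-k * t)
      nlinarith
  have h := hanti (left_mem_Icc.2 hab) (right_mem_Icc.2 hab) hab
  have h3 : exp (k * (b - a)) = exp (-k * a) * exp (k * b) := by
    rw [← exp_add]; congr 1; ring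
  have h4 : exp (-k * b) * exp (k * b) = 1 := by
    rw [← exp_add]; simp
  calc Z b = (Z b * exp (-k * b)) * exp (k * b) := by rw [mul_assoc, h4, mul_one]
    _ ≤ (Z a * exp (-k * a)) * exp (k * b) := by
        exact mul_le_mul_of_nonneg_right h (exp_pos _).le
    _ = _ := by rw [h3]; ring

lemma abs_rpow_sub_rpow_le {p : ℝ} (hp : 1 < p) {M x y : ℝ} (hx : |x| ≤ M) (hy : |y| ≤ M) :
    |x ^ p - y ^ p| ≤ p * M ^ (p - 1) * |x - y| := by
  have := (convex_Icc (-M) M).norm_image_sub_le_of_norm_hasDerivWithin_le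
    (f := fun x : ℝ => x ^ p) (f' := fun x => p * x ^ (p - 1)) (C := p * M ^ (p - 1))
    (fun z _ => (Real.hasDerivAt_rpow_const (Or.inr hp.le)).hasDerivWithinAt)
    (fun z hz => by
      rw [norm_mul, Real.norm_eq_abs, Real.norm_eq_abs, abs_of_pos (by linarith)]
      refine mul_le_mul_of_nonneg_left ?_ (by linarith)
      exact (Real.abs_rpow_le_abs_rpow _ _).trans
        (Real.rpow_le_rpow (abs_nonneg _) (abs_le.2 hz) (by linarith)))
    (abs_le.1 hy) (abs_le.1 hx)
  simpa using this

/-- The potential of `y ^ p - y`, normalised to vanish at `1`. -/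
def potentialAtOne (p y : ℝ) : ℝ := y ^ (p + 1) / (p + 1) - y ^ 2 / 2 + (1 / 2 - 1 / (p + 1))

lemma hasDerivAt_rpow_add_one_div {p : ℝ} (hp : 1 < p) (y : ℝ) :
    HasDerivAt (fun y : ℝ => y ^ (p + 1) / (p + 1)) (y ^ p) y := by
  have h := (Real.hasDerivAt_rpow_const (x := y) (p := p + 1)
    (Or.inr (by linarith))).div_const (p + 1)
  refine h.congr_deriv ?_
  have : p + 1 ≠ 0 := by linarith
  rw [mul_div_cancel_left₀ _ this, add_sub_cancel_right]

lemma hasDerivAt_potentialAtOne {p : ℝ} (hp : 1 < p) (y : ℝ) :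
    HasDerivAt (potentialAtOne p) (y ^ p - y) y := by
  have h := ((hasDerivAt_rpow_add_one_div hp y).sub
    ((hasDerivAt_pow 2 y).div_const 2)).add_const (1 / 2 - 1 / (p + 1))
  exact h.congr_deriv (by norm_num)

lemma potentialAtOne_one (p : ℝ) : potentialAtOne p 1 = 0 := by
  simp [potentialAtOne]

lemma apply_one_le_of_mul_deriv_nonneg {φ φ' : ℝ → ℝ} {a b : ℝ} (ha : a ≤ 1) (hb : 1 ≤ b)
    (hφ : ∀ x, HasDerivAt φ (φ' x) x) (hs : ∀ x ∈ Icc a b, 0 ≤ φ' x * (x - 1)) :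
    ∀ x ∈ Icc a b, φ 1 ≤ φ x := by
  intro x hx
  have hc : Continuous φ := continuous_iff_continuousAt.2 fun x => (hφ x).continuousAt
  have hdf : Differentiable ℝ φ := fun x => (hφ x).differentiableAt
  rcases le_total x 1 with h | h
  · have : AntitoneOn φ (Icc a 1) := by
      apply antitoneOn_of_deriv_nonpos (convex_Icc a 1) hc.continuousOn hdf.differentiableOn
      intro t ht
      rw [interior_Icc] at ht
      rw [(hφ t).deriv]
      have := hs t ⟨ht.1.le, ht.2.le.trans hb⟩
      by_contra hcon
      nlinarith [ht.2]
    exact this ⟨hx.1, h⟩ ⟨ha, le_rfl⟩ h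
  · have : MonotoneOn φ (Icc 1 b) := by
      apply monotoneOn_of_deriv_nonneg (convex_Icc 1 b) hc.continuousOn hdf.differentiableOn
      intro t ht
      rw [interior_Icc] at ht
      rw [(hφ t).deriv]
      have := hs t ⟨ha.trans ht.1.le, ht.2.le⟩
      by_contra hcon
      nlinarith [ht.1]
    exact this ⟨le_rfl, hb⟩ ⟨h, hx.2⟩ h

lemma mul_sq_le_rpow_sub_self_mul {p : ℝ} (hp : 1 < p) {c : ℝ} (hc : 0 < c) :
    ∃ l > 0, ∀ y, c ≤ y → l * (y - 1) ^ 2 ≤ (y ^ p - y) * (y - 1) := by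
  refine ⟨min (p - 1) (c * min 1 (p - 1)), ?_, ?_⟩
  · have : 0 < p - 1 := by linarith
    positivity
  intro y hy
  have hy0 : 0 < y := hc.trans_le hy
  rcases le_total 1 y with h | h
  · have h1 := one_add_mul_self_le_rpow_one_add (s := y - 1) (by linarith) hp.le
    rw [show 1 + (y - 1) = y by ring] at h1
    have h2 : (p - 1) * (y - 1) ^ 2 ≤ (y ^ p - y) * (y - 1) := by nlinarith
    exact (mul_le_mul_of_nonneg_right (min_le_left _ _) (sq_nonneg _)).trans h2
  · have h1 : min 1 (p - 1) * (1 - y) ≤ 1 - y ^ (p - 1) := by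
      rcases le_total 1 (p - 1) with h2 | h2
      · rw [min_eq_left h2]
        have := Real.rpow_le_rpow_of_exponent_ge hy0 h h2
        rw [Real.rpow_one] at this
        linarith
      · rw [min_eq_right h2]
        have := rpow_one_add_le_one_add_mul_self (s := y - 1) (by linarith) (by linarith) h2
        rw [show 1 + (y - 1) = y by ring] at this
        linarith
    have h3 : y ^ p = y * y ^ (p - 1) := by
      conv_rhs => rw [← Real.rpow_one_add' hy0.le (by linarith)]
      congr 1; ring
    have hm : 0 < min 1 (p - 1) := lt_min one_pos (by linarith)
    have h4 : c * min 1 (p - 1) * (y - 1) ^ 2 ≤ (y ^ p - y) * (y - 1) := by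
      rw [h3]
      have e : (y * y ^ (p - 1) - y) * (y - 1) = y * (1 - y ^ (p - 1)) * (1 - y) := by ring
      rw [e]
      have : c * (min 1 (p - 1) * (1 - y)) ≤ y * (1 - y ^ (p - 1)) :=
        mul_le_mul hy h1 (mul_nonneg hm.le (by linarith)) hy0.le
      nlinarith
    exact (mul_le_mul_of_nonneg_right (min_le_right _ _) (sq_nonneg _)).trans h4

lemma rpow_sub_self_bounds {p : ℝ} (hp : 1 < p) {c C : ℝ} (hc : 0 < c) :
    ∃ l > 0, ∃ H > 0, ∀ y ∈ Icc c C, l * (y - 1) ^ 2 ≤ (y ^ p - y) * (y - 1) ∧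
      l / 2 * (y - 1) ^ 2 ≤ potentialAtOne p y ∧ potentialAtOne p y ≤ H / 2 * (y - 1) ^ 2 := by
  obtain ⟨l, hl, hlow⟩ := mul_sq_le_rpow_sub_self_mul hp (lt_min hc one_pos)
  set M := max C 1 with hM
  have hM1 : 1 ≤ M := le_max_right _ _
  have hMp : 0 < M ^ (p - 1) := Real.rpow_pos_of_pos (by linarith) _
  set H := p * M ^ (p - 1) + 1 with hH
  have hH0 : 0 < H := by positivity
  have hup : ∀ y ∈ Icc (min c 1) M, (y ^ p - y) * (y - 1) ≤ H * (y - 1) ^ 2 := by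
    intro y hy
    have hy0 : 0 < y := (lt_min hc one_pos).trans_le hy.1
    have h1 := abs_rpow_sub_rpow_le hp (M := M) (x := y) (y := 1)
      (by rw [abs_of_pos hy0]; exact hy.2) (by simpa using hM1)
    rw [Real.one_rpow] at h1
    have h2 : (y ^ p - 1) * (y - 1) ≤ p * M ^ (p - 1) * (y - 1) ^ 2 := by
      refine (le_abs_self _).trans ?_
      rw [abs_mul, ← sq_abs (y - 1)]
      nlinarith [abs_nonneg (y - 1)]
    nlinarith [sq_nonneg (y - 1)]
  refine ⟨l, hl, H, hH0, fun y hy => ?_⟩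
  have hmem : y ∈ Icc (min c 1) M := ⟨(min_le_left _ _).trans hy.1, hy.2.trans (le_max_left _ _)⟩
  have hq : ∀ r x : ℝ, HasDerivAt (fun x : ℝ => r / 2 * (x - 1) ^ 2) (r * (x - 1)) x := by
    intro r x
    have := (((hasDerivAt_id x).sub_const 1).pow 2).const_mul (r / 2)
    exact this.congr_deriv (by simp; ring)
  refine ⟨hlow y hmem.1, ?_, ?_⟩
  · have := apply_one_le_of_mul_deriv_nonneg (min_le_right c 1) hM1
      (fun x => (hasDerivAt_potentialAtOne hp x).sub (hq l x))
      (fun x hx => by nlinarith [hlow x hx.1]) y hmem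
    simp only [Pi.sub_apply, potentialAtOne_one] at this
    linarith
  · have := apply_one_le_of_mul_deriv_nonneg (min_le_right c 1) hM1
      (fun x => (hq H x).sub (hasDerivAt_potentialAtOne hp x))
      (fun x hx => by nlinarith [hup x hx]) y hmem
    simp only [Pi.sub_apply, potentialAtOne_one] at this
    linarith

lemma abs_rpow_sub_rpow_sub_le_near_one (p : ℝ) {ε : ℝ} (hε : 0 < ε) :
    ∃ η > 0, ∀ x y : ℝ, |x - 1| < η → |y - 1| < η →
      |x ^ p - y ^ p - p * (x - y)| ≤ ε * |x - y| := by
  have h := (Real.hasStrictDerivAt_rpow_const (x := 1) (p := p) (Or.inl one_ne_zero)).isLittleO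
  have h2 := h.def hε
  rw [Metric.eventually_nhds_iff] at h2
  obtain ⟨η, hη, H⟩ := h2
  refine ⟨η, hη, fun x y hx hy => ?_⟩
  have := @H (x, y) (by rw [Prod.dist_eq]; exact max_lt (by simpa [Real.dist_eq] using hx) (by simpa [Real.dist_eq] using hy))
  simpa [mul_comm] using this


/-- Solutions on `ℝ` of `y'' + α y' - y + y ^ p - m ^ 2 e ^ (2 m t) y = 0`. -/
structure DampedSol (α m p : ℝ) (y y' y'' : ℝ → ℝ) : Prop where
  hasDerivAt : ∀ t, HasDerivAt y (y' t) t
  hasDerivAt' : ∀ t, HasDerivAt y' (y'' t) t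
  ode : ∀ t, y'' t + α * y' t - y t + y t ^ p - m ^ 2 * exp (2 * m * t) * y t = 0

/-- The Lyapunov functional of the damped equation (a Pohozaev functional in radial variables). -/
def pohozaev (m p : ℝ) (y y' : ℝ → ℝ) (t : ℝ) : ℝ :=
  y' t ^ 2 / 2 - y t ^ 2 / 2 + y t ^ (p + 1) / (p + 1) - m ^ 2 * exp (2 * m * t) * y t ^ 2 / 2

lemma DampedSol.hasDerivAt_pohozaev {α m p : ℝ} (hp : 1 < p) {y y' y'' : ℝ → ℝ}
    (h : DampedSol α m p y y' y'') (t : ℝ) :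
    HasDerivAt (pohozaev m p y y')
      (-(α * y' t ^ 2) - m ^ 3 * exp (2 * m * t) * y t ^ 2) t := by
  have h1 := ((h.hasDerivAt' t).pow 2).div_const 2
  have h2 := ((h.hasDerivAt t).pow 2).div_const 2
  have h3 := (hasDerivAt_rpow_add_one_div hp (y t)).comp t (h.hasDerivAt t)
  have h4 := ((((hasDerivAt_id t).const_mul (2 * m)).exp.const_mul (m ^ 2)).mul
    ((h.hasDerivAt t).pow 2)).div_const 2
  have h5 := ((h1.sub h2).add h3).sub h4
  refine h5.congr_deriv ?_
  have := h.ode t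
  simp only [Nat.cast_ofNat, Nat.reduceSub, pow_one, mul_one, id, Pi.pow_apply]
  linear_combination y' t * this

lemma DampedSol.antitone_pohozaev {α m p : ℝ} (hα : 0 < α) (hm : 0 < m) (hp : 1 < p)
    {y y' y'' : ℝ → ℝ} (h : DampedSol α m p y y' y'') : Antitone (pohozaev m p y y') := by
  apply antitone_of_deriv_nonpos
  · exact fun t => (h.hasDerivAt_pohozaev hp t).differentiableAt
  · intro t
    rw [(h.hasDerivAt_pohozaev hp t).deriv]
    have h1 : 0 ≤ α * y' t ^ 2 := by positivity
    have h2 : 0 ≤ m ^ 3 * exp (2 * m * t) * y t ^ 2 := by positivity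
    linarith

lemma exists_bound_of_pohozaev_nonpos (m : ℝ) {p D : ℝ} (hp : 1 < p) (hD : 0 ≤ D) :
    ∃ M > 0, ∀ (y y' : ℝ → ℝ) (t : ℝ), 0 < y t → pohozaev m p y y' t ≤ 0 →
      m ^ 2 * exp (2 * m * t) ≤ D → y t ≤ M ∧ |y' t| ≤ M := by
  set Y := ((p + 1) * (1 + D) / 2) ^ (1 / (p - 1)) with hY
  have hY0 : 0 < Y := by positivity
  refine ⟨Y + (1 + D) * Y, by positivity, fun y y' t hy hJ hδ => ?_⟩
  unfold pohozaev at hJ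
  have hy2 : 0 < y t ^ 2 := by positivity
  have hδ2 : m ^ 2 * exp (2 * m * t) * y t ^ 2 ≤ D * y t ^ 2 :=
    mul_le_mul_of_nonneg_right hδ hy2.le
  have hsplit : y t ^ (p + 1) = y t ^ (p - 1) * y t ^ 2 := by
    rw [← Real.rpow_natCast, ← Real.rpow_add hy]; congr 1; push_cast; ring
  have hpow : 0 < y t ^ (p + 1) := Real.rpow_pos_of_pos hy _
  have hpow' : 0 < y t ^ (p + 1) / (p + 1) := by positivity
  have hyY : y t ≤ Y := by
    have h1 : y t ^ (p - 1) / (p + 1) * y t ^ 2 ≤ (1 + D) / 2 * y t ^ 2 := by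
      have : y t ^ (p - 1) / (p + 1) * y t ^ 2 = y t ^ (p + 1) / (p + 1) := by
        rw [hsplit]; ring
      rw [this]
      nlinarith [sq_nonneg (y' t)]
    have h2 := le_of_mul_le_mul_right h1 hy2
    rw [div_le_iff₀ (by linarith)] at h2
    rw [hY, ← Real.rpow_inv_le_iff_of_pos hy.le (by positivity) (by
      apply one_div_pos.2; linarith)]
    simp only [one_div, inv_inv]
    linarith
  refine ⟨by nlinarith, ?_⟩
  have h3 : y' t ^ 2 ≤ (1 + D) * y t ^ 2 := by nlinarith
  have h4 : |y' t| ≤ (1 + D) * y t := by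
    apply abs_le_of_sq_le_sq _ (by positivity)
    nlinarith
  nlinarith

lemma exists_forall_le_mul_exp_le {m : ℝ} (hm : 0 < m) {δ : ℝ} (hδ : 0 < δ) :
    ∃ T, ∀ t ≤ T, m ^ 2 * exp (2 * m * t) ≤ δ := by
  have h : Tendsto (fun t => m ^ 2 * exp (2 * m * t)) atBot (𝓝 (m ^ 2 * 0)) :=
    (tendsto_exp_atBot.comp (tendsto_id.const_mul_atBot (by positivity))).const_mul _
  rw [mul_zero] at h
  obtain ⟨T, hT⟩ := eventually_atBot.1 (h.eventually (ge_mem_nhds hδ))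
  exact ⟨T, hT⟩

lemma exists_exp_neg_mul_le {k δ : ℝ} (hk : 0 < k) (hδ : 0 < δ) :
    ∃ L > 0, ∀ t ≥ L, exp (-k * t) ≤ δ := by
  have h : Tendsto (fun t => exp (-k * t)) atTop (𝓝 0) :=
    tendsto_exp_atBot.comp (tendsto_id.const_mul_atTop_of_neg (by linarith))
  obtain ⟨T, hT⟩ := eventually_atTop.1 (h.eventually (ge_mem_nhds hδ))
  exact ⟨max T 1, by positivity, fun t ht => hT t ((le_max_left _ _).trans ht)⟩

lemma modified_energy_deriv_le {α l H κ k v w y g G δ B : ℝ} (hl : 0 < l)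
    (hκ : 0 < κ) (hκα : κ * (1 + α ^ 2 / (2 * l)) ≤ α / 2) (hk : 0 ≤ k)
    (hk1 : k * (1 + κ) ≤ α) (hk2 : k * (H + κ) ≤ κ * l)
    (hg : l * w ^ 2 ≤ g * w) (hG : G ≤ H / 2 * w ^ 2) (hδ : 0 ≤ δ) (hB : y * (v + κ * w) ≤ B) :
    v * (-α * v - g + δ * y) + g * v + κ * (v * v + w * (-α * v - g + δ * y)) ≤
      -k * (v ^ 2 / 2 + G + κ * (v * w)) + B * δ := by
  have h1 : -(κ * α * (w * v)) ≤ κ * (l / 2) * w ^ 2 + κ * (α ^ 2 / (2 * l)) * v ^ 2 := by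
    have : 0 ≤ κ * (l / 2) * (w + α / l * v) ^ 2 := by positivity
    have e : κ * (l / 2) * (w + α / l * v) ^ 2 =
        κ * (l / 2) * w ^ 2 + κ * (α ^ 2 / (2 * l)) * v ^ 2 + κ * α * (w * v) := by
      field_simp; ring
    linarith
  have h2 := mul_le_mul_of_nonneg_right hκα (sq_nonneg v)
  have h3 := mul_le_mul_of_nonneg_left hg hκ.le
  have h4 := mul_le_mul_of_nonneg_left hB hδ
  have h5 : k * (v ^ 2 / 2 + G + κ * (v * w)) ≤
      k * (1 + κ) * (v ^ 2 / 2) + k * (H + κ) * (w ^ 2 / 2) := by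
    have : κ * (v * w) ≤ κ * (v ^ 2 / 2 + w ^ 2 / 2) :=
      mul_le_mul_of_nonneg_left (by nlinarith [sq_nonneg (v - w)]) hκ.le
    have h6 := mul_le_mul_of_nonneg_left (add_le_add hG this) hk
    nlinarith
  have h7 := mul_le_mul_of_nonneg_right hk1 (by positivity : (0:ℝ) ≤ v ^ 2 / 2)
  have h8 := mul_le_mul_of_nonneg_right hk2 (by positivity : (0:ℝ) ≤ w ^ 2 / 2)
  nlinarith

set_option maxHeartbeats 1000000 in
/-- Positive solutions whose Pohozaev functional is bounded away from `0` are attracted to `1`. -/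
lemma exists_forall_abs_sub_one_le {α m p k₀ ε : ℝ} (hα : 0 < α) (hm : 0 < m) (hp : 1 < p)
    (hk₀ : 0 < k₀) (hε : 0 < ε) :
    ∃ T L : ℝ, 0 < L ∧ ∀ y y' y'' : ℝ → ℝ, DampedSol α m p y y' y'' → (∀ t, 0 < y t) →
      (∀ t, pohozaev m p y y' t ≤ 0) → ∀ S, pohozaev m p y y' S ≤ -k₀ →
      ∀ t, S + L ≤ t → t ≤ T → |y t - 1| ≤ ε := by
  obtain ⟨M, hM, hbd⟩ := exists_bound_of_pohozaev_nonpos m hp zero_le_one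
  obtain ⟨l, hl, H, hH, hlH⟩ := rpow_sub_self_bounds hp (C := M) (Real.sqrt_pos.2 hk₀)
  obtain ⟨κ, hκ, hκ1, hκl, hκα⟩ : ∃ κ > 0, κ ≤ 1 ∧ κ ≤ l / 2 ∧
      κ * (1 + α ^ 2 / (2 * l)) ≤ α / 2 := by
    refine ⟨min 1 (min (l / 2) (α / 2 / (1 + α ^ 2 / (2 * l)))), by positivity,
      min_le_left _ _, (min_le_right _ _).trans (min_le_left _ _), ?_⟩
    rw [← le_div_iff₀ (by positivity)]
    exact (min_le_right _ _).trans (min_le_right _ _)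
  obtain ⟨k, hk, hk1, hk2⟩ : ∃ k > 0, k * (1 + κ) ≤ α ∧ k * (H + κ) ≤ κ * l := by
    refine ⟨min (α / (1 + κ)) (κ * l / (H + κ)), by positivity, ?_, ?_⟩
    · rw [← le_div_iff₀ (by positivity)]; exact min_le_left _ _
    · rw [← le_div_iff₀ (by positivity)]; exact min_le_right _ _
  set B := M * (M + κ * (M + 1)) with hB
  have hB0 : 0 < B := by positivity
  set V₀ := M ^ 2 / 2 + H / 2 * (M + 1) ^ 2 + κ * (M * (M + 1)) with hV₀
  have hV₀0 : 0 < V₀ := by positivity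
  obtain ⟨δ, hδ, hδ1, hδ2⟩ : ∃ δ > 0, δ ≤ 1 ∧ B * δ / k ≤ l * ε ^ 2 / 8 := by
    refine ⟨min 1 (l * ε ^ 2 / 8 * k / B), by positivity, min_le_left _ _, ?_⟩
    rw [div_le_iff₀ hk, mul_comm, ← le_div_iff₀ hB0]
    exact min_le_right _ _
  obtain ⟨T, hT⟩ := exists_forall_le_mul_exp_le hm hδ
  obtain ⟨L, hL, hLexp⟩ := exists_exp_neg_mul_le hk
    (show 0 < l * ε ^ 2 / 8 / V₀ by positivity)
  refine ⟨T, L, hL, fun y y' y'' hsol hpos hJ S hJS t hSt htT => ?_⟩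
  have hest : ∀ s ∈ Icc S t, y s ∈ Icc (√k₀) M ∧ |y' s| ≤ M ∧ |y s - 1| ≤ M + 1 := by
    intro s hs
    have h1 := hbd y y' s (hpos s) (hJ s) ((hT s (hs.2.trans htT)).trans hδ1)
    have h2 := hsol.antitone_pohozaev hα hm hp hs.1
    have h3 : 0 < y s ^ (p + 1) / (p + 1) :=
      div_pos (Real.rpow_pos_of_pos (hpos s) _) (by linarith)
    have h4 := mul_le_mul_of_nonneg_right ((hT s (hs.2.trans htT)).trans hδ1) (sq_nonneg (y s))
    have h5 : k₀ ≤ y s ^ 2 := by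
      simp only [pohozaev] at h2 hJS
      nlinarith [sq_nonneg (y' s)]
    refine ⟨⟨Real.sqrt_le_iff.2 ⟨(hpos s).le, h5⟩, h1.1⟩, h1.2, ?_⟩
    rw [abs_le]
    constructor <;> linarith [hpos s, h1.1]
  set V := fun s => y' s ^ 2 / 2 + potentialAtOne p (y s) + κ * (y' s * (y s - 1)) with hV
  have hVd : ∀ s, HasDerivAt (fun s => V s - B * δ / k)
      (y' s * y'' s + (y s ^ p - y s) * y' s + κ * (y'' s * (y s - 1) + y' s * y' s)) s := by
    intro s
    have h1 := ((hsol.hasDerivAt' s).pow 2).div_const 2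
    have h2 := (hasDerivAt_potentialAtOne hp (y s)).comp s (hsol.hasDerivAt s)
    have h3 := ((hsol.hasDerivAt' s).mul ((hsol.hasDerivAt s).sub_const 1)).const_mul κ
    refine (((h1.add h2).add h3).sub_const (B * δ / k)).congr_deriv ?_
    simp only [Nat.cast_ofNat, Nat.reduceSub, pow_one]
    ring
  have hdecay := le_mul_exp_of_deriv_le (k := -k) (by linarith : S ≤ t) (fun s _ => hVd s) (by
    intro s hs
    obtain ⟨hy, hy', hy1⟩ := hest s hs
    obtain ⟨hg, -, hG⟩ := hlH _ hy
    have hBs : y s * (y' s + κ * (y s - 1)) ≤ B := by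
      have h1 : y' s + κ * (y s - 1) ≤ M + κ * (M + 1) :=
        add_le_add ((le_abs_self _).trans hy')
          (mul_le_mul_of_nonneg_left ((le_abs_self _).trans hy1) hκ.le)
      exact (mul_le_mul_of_nonneg_left h1 (hpos s).le).trans
        (mul_le_mul_of_nonneg_right hy.2 (by positivity))
    have h := modified_energy_deriv_le (δ := m ^ 2 * exp (2 * m * s)) hl hκ hκα hk.le hk1 hk2
      hg hG (by positivity) hBs
    have hode : y'' s = -α * y' s - (y s ^ p - y s) + m ^ 2 * exp (2 * m * s) * y s := by
      linarith [hsol.ode s]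
    have h2 := mul_le_mul_of_nonneg_left (hT s (hs.2.trans htT)) hB0.le
    have h3 : k * (B * δ / k) = B * δ := by field_simp
    rw [← hode] at h
    simp only [hV]
    nlinarith)
  have hVS : V S ≤ V₀ := by
    obtain ⟨hy, hy', hy1⟩ := hest S ⟨le_rfl, by linarith⟩
    obtain ⟨-, -, hG⟩ := hlH _ hy
    have h1 : y' S ^ 2 ≤ M ^ 2 := sq_le_sq' (abs_le.1 hy').1 (abs_le.1 hy').2
    have h2 : (y S - 1) ^ 2 ≤ (M + 1) ^ 2 := sq_le_sq' (abs_le.1 hy1).1 (abs_le.1 hy1).2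
    have h3 : y' S * (y S - 1) ≤ M * (M + 1) := by
      refine (le_abs_self _).trans ?_
      rw [abs_mul]
      gcongr
    have h4 := mul_le_mul_of_nonneg_left h3 hκ.le
    have h5 := mul_le_mul_of_nonneg_left h2 (half_pos hH).le
    simp only [hV, hV₀]
    linarith
  have hVt : l / 4 * (y t - 1) ^ 2 ≤ V t := by
    obtain ⟨hy, -, -⟩ := hest t ⟨by linarith, le_rfl⟩
    obtain ⟨-, hG, -⟩ := hlH _ hy
    have h1 : -(κ * (y' t ^ 2 / 2 + (y t - 1) ^ 2 / 2)) ≤ κ * (y' t * (y t - 1)) := by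
      rw [← mul_neg]
      exact mul_le_mul_of_nonneg_left (by nlinarith [sq_nonneg (y' t + (y t - 1))]) hκ.le
    have h2 := mul_le_mul_of_nonneg_right hκ1 (by positivity : 0 ≤ y' t ^ 2 / 2)
    have h3 := mul_le_mul_of_nonneg_right hκl (by positivity : 0 ≤ (y t - 1) ^ 2 / 2)
    simp only [hV]
    linarith
  have hexp : exp (-k * (t - S)) ≤ l * ε ^ 2 / 8 / V₀ := hLexp _ (by linarith)
  have h6 : (V S - B * δ / k) * exp (-k * (t - S)) ≤ l * ε ^ 2 / 8 := by
    have h7 : 0 < B * δ / k := by positivity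
    calc _ ≤ V₀ * exp (-k * (t - S)) := by
          exact mul_le_mul_of_nonneg_right (by linarith) (exp_pos _).le
      _ ≤ V₀ * (l * ε ^ 2 / 8 / V₀) := mul_le_mul_of_nonneg_left hexp hV₀0.le
      _ = _ := by field_simp
  apply abs_le_of_sq_le_sq _ hε.le
  have h8 : l / 4 * (y t - 1) ^ 2 ≤ l / 4 * ε ^ 2 := by linarith
  exact le_of_mul_le_mul_left h8 (by positivity)


/-- Exponential contraction for small perturbations of `w'' + α w' + q w = 0`. -/
lemma exists_contraction {α q : ℝ} (hα : 0 < α) (hq : 0 < q) :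
    ∃ η > 0, ∃ c > 0, ∃ C > 0, ∀ (w v v' : ℝ → ℝ) (a b : ℝ), a ≤ b →
      (∀ t ∈ Icc a b, HasDerivAt w (v t) t) → (∀ t ∈ Icc a b, HasDerivAt v (v' t) t) →
      (∀ t ∈ Icc a b, |v' t + α * v t + q * w t| ≤ η * |w t|) →
      w b ^ 2 + v b ^ 2 ≤ C * (w a ^ 2 + v a ^ 2) * exp (-c * (b - a)) := by
  obtain ⟨κ, hκ, hκ1, hκq, hκα⟩ : ∃ κ > 0, κ ≤ 1 / 4 ∧ κ ≤ q / 2 ∧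
      κ * (1 + α ^ 2 / (2 * q)) ≤ α / 4 := by
    refine ⟨min (1 / 4) (min (q / 2) (α / 4 / (1 + α ^ 2 / (2 * q)))), by positivity,
      min_le_left _ _, (min_le_right _ _).trans (min_le_left _ _), ?_⟩
    rw [← le_div_iff₀ (by positivity)]
    exact (min_le_right _ _).trans (min_le_right _ _)
  obtain ⟨η, hη, hηα, hηκ⟩ : ∃ η > 0, η ≤ α / 2 ∧ η ≤ κ * q / 6 :=
    ⟨min (α / 2) (κ * q / 6), by positivity, min_le_left _ _, min_le_right _ _⟩
  obtain ⟨c, hc, hc1, hc2⟩ : ∃ c > 0, c * (1 + κ) ≤ α ∧ c * (q + κ) ≤ κ * q / 2 := by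
    refine ⟨min (α / (1 + κ)) (κ * q / 2 / (q + κ)), by positivity, ?_, ?_⟩
    · rw [← le_div_iff₀ (by positivity)]; exact min_le_left _ _
    · rw [← le_div_iff₀ (by positivity)]; exact min_le_right _ _
  obtain ⟨d, hd, hd1, hd2⟩ : ∃ d > 0, d ≤ 1 / 4 ∧ d ≤ q / 4 :=
    ⟨min (1 / 4) (q / 4), by positivity, min_le_left _ _, min_le_right _ _⟩
  refine ⟨η, hη, c, hc, (1 + q) / d, by positivity, fun w v v' a b hab hw hv hle => ?_⟩
  set Q := fun s => v s ^ 2 / 2 + q * (w s ^ 2 / 2) + κ * (v s * w s) with hQ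
  have hQd : ∀ s ∈ Icc a b, HasDerivAt Q
      (v s * v' s + q * (w s * v s) + κ * (v' s * w s + v s * v s)) s := by
    intro s hs
    have h1 := ((hv s hs).pow 2).div_const 2
    have h2 := (((hw s hs).pow 2).div_const 2).const_mul q
    have h3 := ((hv s hs).mul (hw s hs)).const_mul κ
    refine ((h1.add h2).add h3).congr_deriv ?_
    simp only [Nat.cast_ofNat, Nat.reduceSub, pow_one]
    ring
  have hprod : ∀ s, -(κ * (v s ^ 2 / 2 + w s ^ 2 / 2)) ≤ κ * (v s * w s) ∧
      κ * (v s * w s) ≤ κ * (v s ^ 2 / 2 + w s ^ 2 / 2) := by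
    intro s
    constructor
    · rw [← mul_neg]
      exact mul_le_mul_of_nonneg_left (by nlinarith [sq_nonneg (v s + w s)]) hκ.le
    · exact mul_le_mul_of_nonneg_left (by nlinarith [sq_nonneg (v s - w s)]) hκ.le
  have hdecay := le_mul_exp_of_deriv_le (k := -c) hab hQd (by
    intro s hs
    obtain ⟨r, hr⟩ : ∃ r, r = v' s + α * v s + q * w s := ⟨_, rfl⟩
    have hrle : |r| ≤ η * |w s| := hr ▸ hle s hs
    have hv' : v' s = -α * v s - q * w s + r := by rw [hr]; ring
    have h1 : v s * r ≤ η * (v s ^ 2 / 2 + w s ^ 2 / 2) := by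
      refine (le_abs_self _).trans ?_
      rw [abs_mul]
      have := mul_le_mul_of_nonneg_left hrle (abs_nonneg (v s))
      have h2 : |v s| * |w s| ≤ v s ^ 2 / 2 + w s ^ 2 / 2 := by
        rw [← sq_abs (v s), ← sq_abs (w s)]; nlinarith [sq_nonneg (|v s| - |w s|)]
      nlinarith
    have h2 : κ * (r * w s) ≤ η * (w s ^ 2) := by
      have h3 : r * w s ≤ η * w s ^ 2 := by
        refine (le_abs_self _).trans ?_
        rw [abs_mul, ← sq_abs (w s)]
        nlinarith [abs_nonneg (w s)]
      have h4 : 0 ≤ η * w s ^ 2 := by positivity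
      nlinarith
    have h3 : -(κ * α * (w s * v s)) ≤
        κ * (q / 2) * w s ^ 2 + κ * (α ^ 2 / (2 * q)) * v s ^ 2 := by
      have : 0 ≤ κ * (q / 2) * (w s + α / q * v s) ^ 2 := by positivity
      have e : κ * (q / 2) * (w s + α / q * v s) ^ 2 =
          κ * (q / 2) * w s ^ 2 + κ * (α ^ 2 / (2 * q)) * v s ^ 2 + κ * α * (w s * v s) := by
        field_simp; ring
      linarith
    have h4 := mul_le_mul_of_nonneg_right hκα (sq_nonneg (v s))
    have h5 := mul_le_mul_of_nonneg_right hηα (by positivity : 0 ≤ v s ^ 2 / 2)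
    have h6 := mul_le_mul_of_nonneg_right hηκ (by positivity : 0 ≤ w s ^ 2)
    have h7 := mul_le_mul_of_nonneg_right hc1 (by positivity : 0 ≤ v s ^ 2 / 2)
    have h8 := mul_le_mul_of_nonneg_right hc2 (by positivity : 0 ≤ w s ^ 2 / 2)
    have h9 := mul_le_mul_of_nonneg_left (hprod s).2 hc.le
    have e1 : v s * v' s + q * (w s * v s) + κ * (v' s * w s + v s * v s) =
        -α * v s ^ 2 + v s * r + κ * v s ^ 2 - κ * α * (w s * v s) - κ * q * w s ^ 2
          + κ * (r * w s) := by rw [hv']; ring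
    rw [e1]
    simp only [hQ]
    linarith)
  have hup : Q a ≤ (1 + q) * (w a ^ 2 + v a ^ 2) := by
    have h1 := (hprod a).2
    have h2 := mul_le_mul_of_nonneg_right hκ1 (by positivity : 0 ≤ v a ^ 2 / 2 + w a ^ 2 / 2)
    have h3 : 0 ≤ q * w a ^ 2 := by positivity
    have h4 : 0 ≤ q * v a ^ 2 := by positivity
    simp only [hQ]
    nlinarith [sq_nonneg (v a), sq_nonneg (w a)]
  have hlow : d * (w b ^ 2 + v b ^ 2) ≤ Q b := by
    have h1 := (hprod b).1
    have h2 := mul_le_mul_of_nonneg_right hκ1 (by positivity : 0 ≤ v b ^ 2 / 2)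
    have h3 := mul_le_mul_of_nonneg_right hκq (by positivity : 0 ≤ w b ^ 2 / 2)
    have h4 := mul_le_mul_of_nonneg_right hd1 (sq_nonneg (v b))
    have h5 := mul_le_mul_of_nonneg_right hd2 (sq_nonneg (w b))
    simp only [hQ]
    nlinarith [sq_nonneg (v b)]
  have h1 := mul_le_mul_of_nonneg_right hup (exp_pos (-c * (b - a))).le
  rw [div_mul_eq_mul_div, div_mul_eq_mul_div, le_div_iff₀ hd]
  linarith

/-- Continuous dependence for linear differential inequalities of second order. -/
lemma sq_add_sq_le_mul_exp {K : ℝ} (hK : 0 ≤ K) {w v v' : ℝ → ℝ} {a b : ℝ} (hab : a ≤ b)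
    (hw : ∀ t ∈ Icc a b, HasDerivAt w (v t) t) (hv : ∀ t ∈ Icc a b, HasDerivAt v (v' t) t)
    (hle : ∀ t ∈ Icc a b, |v' t| ≤ K * (|w t| + |v t|)) :
    w b ^ 2 + v b ^ 2 ≤ (w a ^ 2 + v a ^ 2) * exp ((1 + 3 * K) * (b - a)) := by
  refine le_mul_exp_of_deriv_le hab (Z := fun t => w t ^ 2 + v t ^ 2)
    (Z' := fun t => 2 * (w t * v t) + 2 * (v t * v' t)) (fun t ht => ?_) (fun t ht => ?_)
  · refine (((hw t ht).pow 2).add ((hv t ht).pow 2)).congr_deriv ?_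
    simp only [Nat.cast_ofNat, Nat.reduceSub, pow_one]
    ring
  · have h1 : v t * v' t ≤ |v t| * (K * (|w t| + |v t|)) := by
      refine (le_abs_self _).trans ?_
      rw [abs_mul]
      exact mul_le_mul_of_nonneg_left (hle t ht) (abs_nonneg _)
    have h2 : |v t| * |w t| ≤ v t ^ 2 / 2 + w t ^ 2 / 2 := by
      rw [← sq_abs (v t), ← sq_abs (w t)]; nlinarith [sq_nonneg (|v t| - |w t|)]
    have h3 := mul_le_mul_of_nonneg_left h2 hK
    have h4 : |v t| * |v t| = v t ^ 2 := by rw [← sq, sq_abs]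
    have h5 : 0 ≤ K * w t ^ 2 := by positivity
    have h6 : |v t| * (K * (|w t| + |v t|)) = K * (|v t| * |w t|) + K * v t ^ 2 := by
      rw [← h4]; ring
    nlinarith [sq_nonneg (v t - w t)]

/-- The derivative of a solution tending to `1` at `-∞` stays bounded there. -/
lemma DampedSol.exists_abs_deriv_le {α m p : ℝ} (hα : 0 < α) (hm : 0 < m)
    {y y' y'' : ℝ → ℝ} (h : DampedSol α m p y y' y'') (hy : Tendsto y atBot (𝓝 1)) :
    ∃ T, ∀ t ≤ T, |y' t| ≤ 3 := by
  have hδ : Tendsto (fun t => m ^ 2 * exp (2 * m * t)) atBot (𝓝 (m ^ 2 * 0)) :=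
    (tendsto_exp_atBot.comp (tendsto_id.const_mul_atBot (by positivity))).const_mul _
  have hrest : Tendsto (fun t => y t - y t ^ p + m ^ 2 * exp (2 * m * t) * y t) atBot (𝓝 0) := by
    have := (hy.sub (hy.rpow_const (p := p) (Or.inl one_ne_zero))).add (hδ.mul hy)
    simpa using this
  have h1 : ∀ᶠ t in atBot, |y t - y t ^ p + m ^ 2 * exp (2 * m * t) * y t| < 1 := by
    have := hrest.eventually (Metric.ball_mem_nhds 0 one_pos)
    simpa [Real.dist_eq] using this
  have h2 : ∀ᶠ t in atBot, |y t - 1| < 1 := by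
    simpa [Real.dist_eq] using hy.eventually (Metric.ball_mem_nhds 1 one_pos)
  obtain ⟨T, hT⟩ := eventually_atBot.1 (h1.and h2)
  refine ⟨T, fun t ht => ?_⟩
  obtain ⟨ξ, hξ, hξe⟩ := exists_hasDerivAt_eq_slope y y' (show t - 1 < t by linarith)
    (fun x _ => (h.hasDerivAt x).continuousAt.continuousWithinAt) (fun x _ => h.hasDerivAt x)
  have hξ2 : |y' ξ| ≤ 2 := by
    rw [hξe, show t - (t - 1) = 1 by ring, div_one]
    have e1 := abs_lt.1 (hT t ht).2
    have e2 := abs_lt.1 (hT (t - 1) (by linarith)).2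
    rw [abs_le]; constructor <;> linarith
  have hmvt := (convex_Icc ξ t).norm_image_sub_le_of_norm_hasDerivWithin_le
    (f := fun x => exp (α * x) * y' x)
    (f' := fun x => exp (α * x) * (y x - y x ^ p + m ^ 2 * exp (2 * m * x) * y x))
    (C := exp (α * t))
    (fun x _ => by
      have h3 := (((hasDerivAt_id x).const_mul α).exp).mul (h.hasDerivAt' x)
      refine (h3.congr_deriv ?_).hasDerivWithinAt
      simp only [id, mul_one]
      linear_combination exp (α * x) * h.ode x)
    (fun x hx => by
      rw [norm_mul, Real.norm_eq_abs, Real.norm_eq_abs, abs_of_pos (exp_pos _)]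
      have e1 : exp (α * x) ≤ exp (α * t) := exp_le_exp.2 (mul_le_mul_of_nonneg_left hx.2 hα.le)
      have e2 := (hT x (hx.2.trans ht)).1.le
      calc _ ≤ exp (α * t) * 1 := mul_le_mul e1 e2 (abs_nonneg _) (exp_pos _).le
        _ = _ := mul_one _)
    (left_mem_Icc.2 hξ.2.le) (right_mem_Icc.2 hξ.2.le)
  simp only [Real.norm_eq_abs] at hmvt
  have e1 : exp (α * ξ) ≤ exp (α * t) := exp_le_exp.2 (mul_le_mul_of_nonneg_left hξ.2.le hα.le)
  have e2 : |exp (α * t) * y' t| ≤ exp (α * t) * 3 := by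
    have e3 : |exp (α * ξ) * y' ξ| ≤ exp (α * t) * 2 := by
      rw [abs_mul, abs_of_pos (exp_pos _)]
      exact mul_le_mul e1 hξ2 (abs_nonneg _) (exp_pos _).le
    have e4 : exp (α * t) * |t - ξ| ≤ exp (α * t) * 1 := by
      refine mul_le_mul_of_nonneg_left ?_ (exp_pos _).le
      rw [abs_le]; constructor <;> linarith [hξ.1, hξ.2]
    have e5 := abs_sub_abs_le_abs_sub (exp (α * t) * y' t) (exp (α * ξ) * y' ξ)
    linarith
  rw [abs_mul, abs_of_pos (exp_pos _)] at e2
  exact le_of_mul_le_mul_left e2 (exp_pos _)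

/-- Two solutions satisfy a linear second order differential inequality on compact intervals. -/
lemma DampedSol.exists_abs_sub_le {α m p : ℝ} (hα : 0 < α) (hm : 0 < m) (hp : 1 < p)
    {z z' z'' : ℝ → ℝ} (hz : DampedSol α m p z z' z'') (T₀ T₁ : ℝ) :
    ∃ K > 0, ∀ y y' y'' : ℝ → ℝ, DampedSol α m p y y' y'' → (∀ t, 0 < y t) →
      (∀ t, pohozaev m p y y' t ≤ 0) →
      ∀ t ∈ Icc T₀ T₁, |y'' t - z'' t| ≤ K * (|y t - z t| + |y' t - z' t|) := by
  set D := m ^ 2 * exp (2 * m * T₁) with hD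
  have hD0 : 0 < D := by positivity
  have hDle : ∀ t ≤ T₁, m ^ 2 * exp (2 * m * t) ≤ D := fun t ht => by
    refine mul_le_mul_of_nonneg_left (exp_le_exp.2 ?_) (by positivity)
    exact mul_le_mul_of_nonneg_left ht (by positivity)
  obtain ⟨M₀, hM₀, hbd⟩ := exists_bound_of_pohozaev_nonpos m hp hD0.le
  obtain ⟨M₁, hM₁⟩ := (isCompact_Icc (a := T₀) (b := T₁)).exists_bound_of_continuousOn
    (f := z) fun x _ => (hz.hasDerivAt x).continuousAt.continuousWithinAt
  set M := max M₀ M₁ with hM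
  have hM0 : 0 < M := hM₀.trans_le (le_max_left _ _)
  refine ⟨α + 1 + p * M ^ (p - 1) + D, by positivity, fun y y' y'' hy hpos hJ s hs => ?_⟩
  have h1 := (hbd y y' s (hpos _) (hJ _) (hDle _ hs.2)).1
  have h2 := hM₁ s hs
  have h3 := abs_rpow_sub_rpow_le hp (M := M)
    (show |y s| ≤ M by rw [abs_of_pos (hpos s)]; exact h1.trans (le_max_left _ _))
    (show |z s| ≤ M from h2.trans (le_max_right _ _))
  have e : y'' s - z'' s = -(α * (y' s - z' s)) + (y s - z s) - (y s ^ p - z s ^ p) +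
      m ^ 2 * exp (2 * m * s) * (y s - z s) := by
    linear_combination hy.ode s - hz.ode s
  rw [e]
  refine (abs_add_le _ _).trans ((add_le_add_left ((abs_sub _ _).trans
    (add_le_add_left (abs_add_le _ _) _)) _).trans ?_)
  rw [abs_neg, abs_mul, abs_mul (m ^ 2 * exp (2 * m * s)), abs_of_pos hα,
    abs_of_pos (show 0 < m ^ 2 * exp (2 * m * s) by positivity)]
  have h4 := mul_le_mul_of_nonneg_right (hDle s hs.2) (abs_nonneg (y s - z s))
  have h5 : 0 ≤ (1 + p * M ^ (p - 1) + D) * |y' s - z' s| := by positivity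
  have h6 : 0 ≤ α * |y s - z s| := by positivity
  linarith

set_option maxHeartbeats 1000000 in
/-- Positive solutions with nonpositive Pohozaev functional, bounded away from `0` far to the
left, are uniformly close to the solution tending to `1` at `-∞`. -/
theorem exists_forall_sq_add_sq_le {α m p : ℝ} (hα : 0 < α) (hm : 0 < m) (hp : 1 < p)
    {z z' z'' : ℝ → ℝ} (hz : DampedSol α m p z z' z'') (hz1 : Tendsto z atBot (𝓝 1))
    {k₀ ε T₀ T₁ : ℝ} (hk₀ : 0 < k₀) (hε : 0 < ε) :
    ∃ S, ∀ y y' y'' : ℝ → ℝ, DampedSol α m p y y' y'' → (∀ t, 0 < y t) →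
      (∀ t, pohozaev m p y y' t ≤ 0) → pohozaev m p y y' S ≤ -k₀ →
      ∀ t ∈ Icc T₀ T₁, (y t - z t) ^ 2 + (y' t - z' t) ^ 2 ≤ ε := by
  obtain ⟨η, hη, c, hc, C, hC, hcontr⟩ := exists_contraction hα (sub_pos.2 hp)
  obtain ⟨r, hr, hnear⟩ := abs_rpow_sub_rpow_sub_le_near_one p (half_pos hη)
  obtain ⟨T₂, L, hL, hatt⟩ := exists_forall_abs_sub_one_le hα hm hp hk₀ (half_pos hr)
  obtain ⟨T₃, hT₃⟩ := exists_forall_le_mul_exp_le hm (half_pos hη)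
  obtain ⟨T₄, hT₄⟩ := hz.exists_abs_deriv_le hα hm hz1
  obtain ⟨T₅, hT₅⟩ := eventually_atBot.1 (hz1.eventually (Metric.ball_mem_nhds 1 hr))
  obtain ⟨T, hTle⟩ : ∃ T, T ≤ T₀ ∧ T ≤ T₁ ∧ T ≤ T₂ ∧ T ≤ T₃ ∧ T ≤ T₄ ∧ T ≤ T₅ :=
    ⟨min T₀ (min T₁ (min T₂ (min T₃ (min T₄ T₅)))), by simp⟩
  obtain ⟨hT0, hT1, hT2, hT3, hT4, hT5⟩ := hTle
  set D := m ^ 2 * exp (2 * m * T₁) with hD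
  have hD0 : 0 < D := by positivity
  have hDle : ∀ t ≤ T₁, m ^ 2 * exp (2 * m * t) ≤ D := fun t ht => by
    refine mul_le_mul_of_nonneg_left (exp_le_exp.2 ?_) (by positivity)
    exact mul_le_mul_of_nonneg_left ht (by positivity)
  obtain ⟨M₀, hM₀, hbd⟩ := exists_bound_of_pohozaev_nonpos m hp hD0.le
  obtain ⟨K, hK0, hK⟩ := hz.exists_abs_sub_le hα hm hp T T₁
  set W := C * (r ^ 2 * 4 + (M₀ + 3) ^ 2) * exp ((1 + 3 * K) * (T₁ - T)) with hW
  have hW0 : 0 < W := by positivity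
  obtain ⟨L', hL', hexp⟩ := exists_exp_neg_mul_le hc (show 0 < ε / W by positivity)
  refine ⟨T - L' - L, fun y y' y'' hy hpos hJ hJS t ht => ?_⟩
  have hw : ∀ s, HasDerivAt (fun s => y s - z s) (y' s - z' s) s := fun s =>
    (hy.hasDerivAt s).sub (hz.hasDerivAt s)
  have hv : ∀ s, HasDerivAt (fun s => y' s - z' s) (y'' s - z'' s) s := fun s =>
    (hy.hasDerivAt' s).sub (hz.hasDerivAt' s)
  have hclose : ∀ s ∈ Icc (T - L') T, |y s - 1| < r ∧ |z s - 1| < r := fun s hs =>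
    ⟨(hatt y y' y'' hy hpos hJ _ hJS s (by linarith [hs.1]) (hs.2.trans hT2)).trans_lt
      (by linarith), by
      have := hT₅ s (hs.2.trans hT5)
      rwa [Real.dist_eq] at this⟩
  have hfirst := hcontr _ _ _ (T - L') T (by linarith) (fun s _ => hw s) (fun s _ => hv s) (by
    intro s hs
    obtain ⟨h1, h2⟩ := hclose s hs
    have h3 := hnear _ _ h1 h2
    have e : y'' s - z'' s + α * (y' s - z' s) + (p - 1) * (y s - z s) =
        -(y s ^ p - z s ^ p - p * (y s - z s)) +
          m ^ 2 * exp (2 * m * s) * (y s - z s) := by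
      linear_combination hy.ode s - hz.ode s
    rw [e]
    refine (abs_add_le _ _).trans ?_
    rw [abs_neg, abs_mul (m ^ 2 * exp (2 * m * s)),
      abs_of_pos (show 0 < m ^ 2 * exp (2 * m * s) by positivity)]
    have h4 := mul_le_mul_of_nonneg_right (hT₃ s (hs.2.trans hT3)) (abs_nonneg (y s - z s))
    linarith)
  have hstart : (y (T - L') - z (T - L')) ^ 2 + (y' (T - L') - z' (T - L')) ^ 2 ≤
      r ^ 2 * 4 + (M₀ + 3) ^ 2 := by
    obtain ⟨h1, h2⟩ := hclose (T - L') ⟨le_rfl, by linarith⟩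
    have h3 := (hbd y y' (T - L') (hpos _) (hJ _) (hDle _ (by linarith))).2
    have h4 := hT₄ (T - L') (by linarith)
    rw [abs_lt] at h1 h2
    rw [abs_le] at h3 h4
    have h5 : (y (T - L') - z (T - L')) ^ 2 ≤ (2 * r) ^ 2 :=
      sq_le_sq' (by linarith [h1.1, h2.2]) (by linarith [h1.2, h2.1])
    have h6 : (y' (T - L') - z' (T - L')) ^ 2 ≤ (M₀ + 3) ^ 2 :=
      sq_le_sq' (by linarith [h3.1, h4.2]) (by linarith [h3.2, h4.1])
    linarith
  have hsecond := sq_add_sq_le_mul_exp hK0.le (show T ≤ t from hT0.trans ht.1)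
    (fun s _ => hw s) (fun s _ => hv s)
    (fun s hs => hK y y' y'' hy hpos hJ s ⟨hs.1, hs.2.trans ht.2⟩)
  refine hsecond.trans ?_
  have h1 : exp ((1 + 3 * K) * (t - T)) ≤ exp ((1 + 3 * K) * (T₁ - T)) :=
    exp_le_exp.2 (mul_le_mul_of_nonneg_left (by linarith [ht.2]) (by positivity))
  have h2 := hexp L' le_rfl
  rw [show T - (T - L') = L' by ring] at hfirst
  calc _ ≤ (C * (r ^ 2 * 4 + (M₀ + 3) ^ 2) * exp (-c * L')) *
        exp ((1 + 3 * K) * (T₁ - T)) := by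
        refine mul_le_mul (hfirst.trans ?_) h1 (exp_pos _).le (by positivity)
        exact mul_le_mul_of_nonneg_right (mul_le_mul_of_nonneg_left hstart hC.le) (exp_pos _).le
    _ = W * exp (-c * L') := by rw [hW]; ring
    _ ≤ W * (ε / W) := mul_le_mul_of_nonneg_left h2 hW0.le
    _ = ε := by field_simp

theorem exists_forall_abs_sub_le {α m p : ℝ} (hα : 0 < α) (hm : 0 < m) (hp : 1 < p)
    {z z' z'' : ℝ → ℝ} (hz : DampedSol α m p z z' z'') (hz1 : Tendsto z atBot (𝓝 1))
    {k₀ ε : ℝ} (hk₀ : 0 < k₀) (hε : 0 < ε) (T₀ T₁ : ℝ) :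
    ∃ S, ∀ y y' y'' : ℝ → ℝ, DampedSol α m p y y' y'' → (∀ t, 0 < y t) →
      (∀ t, pohozaev m p y y' t ≤ 0) → pohozaev m p y y' S ≤ -k₀ →
      ∀ t ∈ Icc T₀ T₁, |y t - z t| ≤ ε ∧ |y' t - z' t| ≤ ε ∧ |y'' t - z'' t| ≤ ε := by
  obtain ⟨K, hK0, hK⟩ := hz.exists_abs_sub_le hα hm hp T₀ T₁
  obtain ⟨δ, hδ, hδ1, hδ2⟩ : ∃ δ > 0, δ ≤ ε ∧ K * (δ + δ) ≤ ε := by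
    refine ⟨min ε (ε / (2 * K)), by positivity, min_le_left _ _, ?_⟩
    have := min_le_right ε (ε / (2 * K))
    rw [le_div_iff₀ (by positivity)] at this
    linarith
  obtain ⟨S, hS⟩ := exists_forall_sq_add_sq_le hα hm hp hz hz1 (T₀ := T₀) (T₁ := T₁) hk₀
    (show 0 < δ ^ 2 by positivity)
  refine ⟨S, fun y y' y'' hy hpos hJ hJS t ht => ?_⟩
  have h := hS y y' y'' hy hpos hJ hJS t ht
  have h1 : |y t - z t| ≤ δ := abs_le_of_sq_le_sq (by nlinarith [sq_nonneg (y' t - z' t)]) hδ.le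
  have h2 : |y' t - z' t| ≤ δ := abs_le_of_sq_le_sq (by nlinarith [sq_nonneg (y t - z t)]) hδ.le
  exact ⟨h1.trans hδ1, h2.trans hδ1, (hK y y' y'' hy hpos hJ t ht).trans
    ((mul_le_mul_of_nonneg_left (add_le_add h1 h2) hK0.le).trans hδ2)⟩


lemma mul_rpow_of_pos_left {c : ℝ} (hc : 0 < c) (x p : ℝ) : (c * x) ^ p = c ^ p * x ^ p := by
  rcases le_or_gt 0 x with hx | hx
  · exact Real.mul_rpow hc.le hx
  · rw [Real.rpow_def_of_neg (mul_neg_of_pos_of_neg hc hx), Real.rpow_def_of_neg hx,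
      Real.rpow_def_of_pos hc, Real.log_mul hc.ne' hx.ne, add_mul, exp_add]
    ring

/-- The Emden–Fowler transform `y(t) = A⁻¹ s ^ θ u(s)`, `s = e ^ (m t)`. -/
def emden (A m θ : ℝ) (u : ℝ → ℝ) (t : ℝ) : ℝ := A⁻¹ * exp (m * θ * t) * u (exp (m * t))

/-- The derivative of `emden`. -/
def emdenDeriv (A m θ : ℝ) (u u' : ℝ → ℝ) (t : ℝ) : ℝ :=
  m * A⁻¹ * exp (m * θ * t) * (θ * u (exp (m * t)) + exp (m * t) * u' (exp (m * t)))

/-- The second derivative of `emden`. -/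
def emdenDeriv₂ (A m θ : ℝ) (u u' u'' : ℝ → ℝ) (t : ℝ) : ℝ :=
  m ^ 2 * A⁻¹ * exp (m * θ * t) * (θ ^ 2 * u (exp (m * t)) +
    (2 * θ + 1) * (exp (m * t) * u' (exp (m * t))) + exp (m * t) ^ 2 * u'' (exp (m * t)))

lemma hasDerivAt_exp_const_mul (c t : ℝ) :
    HasDerivAt (fun t => exp (c * t)) (c * exp (c * t)) t :=
  ((hasDerivAt_id t).const_mul c).exp.congr_deriv (by simp [mul_comm])

lemma hasDerivAt_emden (A m θ : ℝ) {u u' : ℝ → ℝ} {t : ℝ}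
    (hu : HasDerivAt u (u' (exp (m * t))) (exp (m * t))) :
    HasDerivAt (emden A m θ u) (emdenDeriv A m θ u u' t) t := by
  have h1 := hu.comp t (hasDerivAt_exp_const_mul m t)
  refine (((hasDerivAt_exp_const_mul (m * θ) t).const_mul A⁻¹).mul h1).congr_deriv ?_
  simp only [emdenDeriv, Function.comp]
  ring

lemma hasDerivAt_emdenDeriv (A m θ : ℝ) {u u' u'' : ℝ → ℝ} {t : ℝ}
    (hu : HasDerivAt u (u' (exp (m * t))) (exp (m * t)))
    (hu' : HasDerivAt u' (u'' (exp (m * t))) (exp (m * t))) :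
    HasDerivAt (emdenDeriv A m θ u u') (emdenDeriv₂ A m θ u u' u'' t) t := by
  have h0 := hasDerivAt_exp_const_mul m t
  have h1 := hu.comp t h0
  have h2 := hu'.comp t h0
  refine (((hasDerivAt_exp_const_mul (m * θ) t).const_mul (m * A⁻¹)).mul
    ((h1.const_mul θ).add (h0.mul h2))).congr_deriv ?_
  simp only [emdenDeriv₂, Function.comp, Pi.add_apply, Pi.mul_apply]
  ring

lemma dampedSol_emden {A m θ n p : ℝ} (hA : 0 < A) (hm : m ^ 2 * (θ * (n - 2 - θ)) = 1)
    (hAm : A ^ (p - 1) * m ^ 2 = 1) (hθ : θ * (p - 1) = 2) {u u' u'' : ℝ → ℝ}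
    (hu : ∀ s > 0, HasDerivAt u (u' s) s) (hu' : ∀ s > 0, HasDerivAt u' (u'' s) s)
    (hode : ∀ s > 0, u'' s + (n - 1) / s * u' s + fNL p (u s) = 0) :
    DampedSol (m * (n - 2 - 2 * θ)) m p (emden A m θ u) (emdenDeriv A m θ u u')
      (emdenDeriv₂ A m θ u u' u'') where
  hasDerivAt t := hasDerivAt_emden A m θ (hu _ (exp_pos _))
  hasDerivAt' t := hasDerivAt_emdenDeriv A m θ (hu _ (exp_pos _)) (hu' _ (exp_pos _))
  ode t := by
    have h := hode _ (exp_pos (m * t))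
    simp only [emden, emdenDeriv, emdenDeriv₂]
    have hpow : (A⁻¹ * exp (m * θ * t) * u (exp (m * t))) ^ p =
        m ^ 2 * A⁻¹ * exp (m * θ * t) * exp (m * t) ^ 2 * u (exp (m * t)) ^ p := by
      rw [mul_rpow_of_pos_left (by positivity), Real.mul_rpow (by positivity) (exp_pos _).le]
      have e1 : A⁻¹ ^ p = m ^ 2 * A⁻¹ := by
        have : A⁻¹ ^ p = A⁻¹ ^ (p - 1) * A⁻¹ := by
          conv_rhs => rw [← Real.rpow_add_one (inv_pos.2 hA).ne']
          congr 1; ring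
        rw [this, Real.inv_rpow hA.le, inv_eq_of_mul_eq_one_right hAm]
      have e2 : exp (m * θ * t) ^ p = exp (m * θ * t) * exp (m * t) ^ 2 := by
        rw [← Real.exp_mul, ← Real.exp_nat_mul, ← exp_add]
        congr 1
        push_cast
        linear_combination m * t * hθ
      rw [e1, e2]; ring
    rw [hpow]
    have he : exp (2 * m * t) = exp (m * t) ^ 2 := by
      rw [← Real.exp_nat_mul]; congr 1; push_cast; ring
    rw [he]
    set s := exp (m * t) with hs
    have hs0 : s ≠ 0 := (exp_pos _).ne'
    simp only [fNL] at h
    field_simp at h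
    linear_combination m ^ 2 * A⁻¹ * exp (m * θ * t) * s * h + A⁻¹ * exp (m * θ * t) * u s * hm

/-- Differentiating `A s ^ r g(m⁻¹ log s)`. -/
lemma hasDerivAt_mul_rpow_mul_comp_log (A m r : ℝ) {g g' : ℝ → ℝ} {s : ℝ} (hs : 0 < s)
    (hg : HasDerivAt g (g' (log s / m)) (log s / m)) :
    HasDerivAt (fun s => A * s ^ r * g (log s / m))
      (A * s ^ (r - 1) * (r * g (log s / m) + g' (log s / m) / m)) s := by
  have h1 := hg.comp s ((Real.hasDerivAt_log hs.ne').div_const m)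
  have h2 := (Real.hasDerivAt_rpow_const (p := r) (Or.inl hs.ne')).const_mul A
  refine (h2.mul h1).congr_deriv ?_
  simp only [Function.comp]
  have : s ^ r = s ^ (r - 1) * s := by
    rw [← Real.rpow_add_one hs.ne']; congr 1; ring
  rw [this]
  field_simp


lemma IsIVPSol.hasDerivAt {N : ℕ} {p γ : ℝ} {u u' u'' : ℝ → ℝ} (h : IsIVPSol N p γ u u' u'')
    {s : ℝ} (hs : 0 < s) : HasDerivAt u (u' s) s :=
  (h.1 s hs.le).hasDerivAt (Ici_mem_nhds hs)

lemma IsIVPSol.hasDerivAt' {N : ℕ} {p γ : ℝ} {u u' u'' : ℝ → ℝ} (h : IsIVPSol N p γ u u' u'')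
    {s : ℝ} (hs : 0 < s) : HasDerivAt u' (u'' s) s :=
  (h.2.1 s hs.le).hasDerivAt (Ici_mem_nhds hs)

lemma IsIVPSol.continuousOn {N : ℕ} {p γ : ℝ} {u u' u'' : ℝ → ℝ} (h : IsIVPSol N p γ u u' u'') :
    ContinuousOn u (Ici 0) := fun s hs => (h.1 s hs).continuousWithinAt

lemma IsIVPSol.continuousOn' {N : ℕ} {p γ : ℝ} {u u' u'' : ℝ → ℝ} (h : IsIVPSol N p γ u u' u'') :
    ContinuousOn u' (Ici 0) := fun s hs => (h.2.1 s hs).continuousWithinAt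

lemma IsIVPSol.ode {N : ℕ} {p γ : ℝ} {u u' u'' : ℝ → ℝ} (h : IsIVPSol N p γ u u' u'')
    {s : ℝ} (hs : 0 < s) : u'' s + ((N : ℝ) - 1) / s * u' s + fNL p (u s) = 0 :=
  h.2.2.2.2.2 s hs

lemma monotoneOn_Ici_zero {f f' : ℝ → ℝ} (hc : ContinuousOn f (Ici 0))
    (hd : ∀ s > 0, HasDerivAt f (f' s) s) (hf' : ∀ s > 0, 0 ≤ f' s) : MonotoneOn f (Ici 0) := by
  apply monotoneOn_of_deriv_nonneg (convex_Ici 0) hc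
  · intro s hs
    rw [interior_Ici] at hs
    exact (hd s hs).differentiableAt.differentiableWithinAt
  · intro s hs
    rw [interior_Ici] at hs
    rw [(hd s hs).deriv]
    exact hf' s hs

lemma strictMonoOn_potentialAtOne {p : ℝ} (hp : 1 < p) :
    StrictMonoOn (potentialAtOne p) (Ici 1) := by
  apply strictMonoOn_of_deriv_pos (convex_Ici 1)
  · exact fun y _ => (hasDerivAt_potentialAtOne hp y).continuousAt.continuousWithinAt
  · intro y hy
    rw [interior_Ici] at hy
    rw [(hasDerivAt_potentialAtOne hp y).deriv, sub_pos]
    simpa using Real.rpow_lt_rpow_of_exponent_lt hy hp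

lemma IsIVPSol.le_initial {N : ℕ} (hN : 3 ≤ N) {p γ : ℝ} (hp : 1 < p) (hγ : 1 < γ)
    {u u' u'' : ℝ → ℝ} (h : IsIVPSol N p γ u u' u'') {s : ℝ} (hs : 0 ≤ s) : u s ≤ γ := by
  have hN' : (3 : ℝ) ≤ N := by exact_mod_cast hN
  have hG : Continuous (potentialAtOne p) :=
    continuous_iff_continuousAt.2 fun y => (hasDerivAt_potentialAtOne hp y).continuousAt
  have hmono : MonotoneOn (fun s => -(u' s ^ 2 / 2 + potentialAtOne p (u s))) (Ici 0) := by
    refine monotoneOn_Ici_zero (f' := fun s => ((N : ℝ) - 1) / s * u' s ^ 2) ?_ ?_ ?_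
    · exact (((h.continuousOn'.pow 2).div_const 2).add (hG.comp_continuousOn h.continuousOn)).neg
    · intro s hs
      refine ((((h.hasDerivAt' hs).pow 2).div_const 2).add
        ((hasDerivAt_potentialAtOne hp (u s)).comp s (h.hasDerivAt hs))).neg.congr_deriv ?_
      have := h.ode hs
      simp only [fNL] at this
      simp only [Nat.cast_ofNat, Nat.reduceSub, pow_one]
      linear_combination -u' s * this
    · intro s hs
      have : (0 : ℝ) ≤ N - 1 := by linarith
      positivity
  have h1 := hmono (mem_Ici.2 le_rfl) (mem_Ici.2 hs) hs
  simp only [h.2.2.2.1, h.2.2.2.2.1] at h1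
  by_contra! hcon
  have h2 := strictMonoOn_potentialAtOne hp (mem_Ici.2 hγ.le)
    (mem_Ici.2 (hγ.le.trans hcon.le)) hcon
  nlinarith [sq_nonneg (u' s)]

lemma IsIVPSol.neg_le_deriv {N : ℕ} (hN : 3 ≤ N) {p γ : ℝ} (hp : 1 < p) (hγ : 1 < γ)
    {u u' u'' : ℝ → ℝ} (h : IsIVPSol N p γ u u' u'') (hpos : ∀ s > 0, 0 < u s) {s : ℝ}
    (hs : 0 < s) : -(γ ^ p * s / N) ≤ u' s := by
  obtain ⟨n, rfl⟩ : ∃ n, N = n + 1 := ⟨N - 1, by omega⟩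
  have hn : ((n + 1 : ℕ) : ℝ) - 1 = n := by push_cast; ring
  have hN0 : ((n + 1 : ℕ) : ℝ) ≠ 0 := by positivity
  have hmono : MonotoneOn (fun s => s ^ n * (u' s + γ ^ p / (n + 1 : ℕ) * s)) (Ici 0) := by
    refine monotoneOn_Ici_zero (f' := fun s => s ^ n * (u s - u s ^ p + γ ^ p)) ?_ ?_ ?_
    · exact (continuous_pow n).continuousOn.mul
        (h.continuousOn'.add (continuous_const.mul continuous_id).continuousOn)
    · intro s hs
      refine (((hasDerivAt_id s).pow n).mul ((h.hasDerivAt' hs).add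
        ((hasDerivAt_id s).const_mul _))).congr_deriv ?_
      have hode := h.ode hs
      simp only [fNL, hn] at hode
      have hsn : (n : ℝ) * s ^ (n - 1) = n / s * s ^ n := by
        rcases n with _ | k
        · simp
        · simp only [Nat.add_sub_cancel, pow_succ]; field_simp
      simp only [id, mul_one, hsn, Pi.add_apply, Pi.pow_apply]
      have e : γ ^ p = γ ^ p / (n + 1 : ℕ) * (n + 1) := by
        push_cast at hN0 ⊢; field_simp
      have e2 : (n : ℝ) / s * s = n := by field_simp
      linear_combination s ^ n * hode - s ^ n * e + s ^ n * (γ ^ p / (n + 1 : ℕ)) * e2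
    · intro s hs
      have h1 : u s ^ p ≤ γ ^ p :=
        Real.rpow_le_rpow (hpos s hs).le (h.le_initial hN hp hγ hs.le) (by linarith)
      have h2 := hpos s hs
      have : 0 ≤ u s - u s ^ p + γ ^ p := by linarith
      positivity
  have h1 := hmono (mem_Ici.2 le_rfl) (mem_Ici.2 hs.le) hs.le
  simp only [h.2.2.2.2.1, mul_zero, add_zero] at h1
  have h2 := nonneg_of_mul_nonneg_right h1 (by positivity)
  have e : γ ^ p * s / (n + 1 : ℕ) = γ ^ p / (n + 1 : ℕ) * s := by ring
  rw [e]
  linarith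

lemma IsIVPSol.le_apply {N : ℕ} (hN : 3 ≤ N) {p γ : ℝ} (hp : 1 < p) (hγ : 1 < γ)
    {u u' u'' : ℝ → ℝ} (h : IsIVPSol N p γ u u' u'') (hpos : ∀ s > 0, 0 < u s) {s : ℝ}
    (hs : 0 < s) : γ - γ ^ p * s ^ 2 / (2 * N) ≤ u s := by
  have hmono : MonotoneOn (fun s => u s + γ ^ p / (2 * N) * s ^ 2) (Ici 0) := by
    refine monotoneOn_Ici_zero (f' := fun s => u' s + γ ^ p * s / N) ?_ ?_ ?_
    · exact h.continuousOn.add (continuous_const.mul (continuous_pow 2)).continuousOn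
    · intro s hs
      refine ((h.hasDerivAt hs).add ((hasDerivAt_pow 2 s).const_mul _)).congr_deriv ?_
      have hN0 : (N : ℝ) ≠ 0 := by positivity
      simp only [Nat.cast_ofNat, Nat.reduceSub, pow_one]
      field_simp
    · intro s hs
      linarith [h.neg_le_deriv hN hp hγ hpos hs]
  have h1 := hmono (mem_Ici.2 le_rfl) (mem_Ici.2 hs.le) hs.le
  simp only [h.2.2.2.1] at h1
  have e : γ ^ p * s ^ 2 / (2 * N) = γ ^ p / (2 * N) * s ^ 2 := by ring
  rw [e]
  linarith

lemma tendsto_exp_const_mul_atBot {c : ℝ} (hc : 0 < c) :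
    Tendsto (fun t => exp (c * t)) atBot (𝓝 0) :=
  tendsto_exp_atBot.comp (tendsto_id.const_mul_atBot hc)

lemma tendsto_comp_exp_atBot {f : ℝ → ℝ} (hf : ContinuousOn f (Ici 0)) {m : ℝ} (hm : 0 < m) :
    Tendsto (fun t => f (exp (m * t))) atBot (𝓝 (f 0)) :=
  (hf 0 (mem_Ici.2 le_rfl)).tendsto.comp (tendsto_nhdsWithin_iff.2
    ⟨tendsto_exp_const_mul_atBot hm, Eventually.of_forall fun _ => (exp_pos _).le⟩)

lemma IsIVPSol.tendsto_pohozaev {N : ℕ} {p γ A m θ : ℝ} (hp : 1 < p) (hm : 0 < m) (hθ : 0 < θ)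
    {u u' u'' : ℝ → ℝ} (h : IsIVPSol N p γ u u' u'') :
    Tendsto (pohozaev m p (emden A m θ u) (emdenDeriv A m θ u u')) atBot (𝓝 0) := by
  have h0 := tendsto_exp_const_mul_atBot (mul_pos hm hθ)
  have h1 := tendsto_comp_exp_atBot h.continuousOn hm
  have h2 := tendsto_comp_exp_atBot h.continuousOn' hm
  have hy : Tendsto (emden A m θ u) atBot (𝓝 0) := by
    have h3 := (h0.const_mul A⁻¹).mul h1
    rw [mul_zero, zero_mul] at h3
    exact h3
  have hy' : Tendsto (emdenDeriv A m θ u u') atBot (𝓝 0) := by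
    have h3 := (h0.const_mul (m * A⁻¹)).mul
      ((h1.const_mul θ).add ((tendsto_exp_const_mul_atBot hm).mul h2))
    rw [mul_zero, zero_mul] at h3
    exact h3
  have h3 := (tendsto_exp_const_mul_atBot (mul_pos two_pos hm)).const_mul (m ^ 2)
  have h4 := hy.rpow_const (p := p + 1) (Or.inr (by linarith))
  have h5 := ((((hy'.pow 2).div_const 2).sub ((hy.pow 2).div_const 2)).add
    (h4.div_const (p + 1))).sub ((h3.mul (hy.pow 2)).div_const 2)
  rw [Real.zero_rpow (by linarith), show ((0 : ℝ) ^ 2 / 2 - 0 ^ 2 / 2 + 0 / (p + 1) -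
    m ^ 2 * 0 * 0 ^ 2 / 2) = 0 by simp] at h5
  exact h5

lemma IsIVPSol.eventually_emden_pos {N : ℕ} {p γ A m θ : ℝ} (hγ : 0 < γ) (hA : 0 < A) (hm : 0 < m)
    {u u' u'' : ℝ → ℝ} (h : IsIVPSol N p γ u u' u'') :
    ∀ᶠ t in atBot, 0 < emden A m θ u t := by
  have h1 := tendsto_comp_exp_atBot h.continuousOn hm
  rw [h.2.2.2.1] at h1
  filter_upwards [h1.eventually (lt_mem_nhds hγ)] with t ht
  simp only [emden]
  positivity

/-- A solution of the damped equation that starts positive and whose Pohozaev functional vanishes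
at `-∞` stays positive. -/
lemma DampedSol.pos_of_tendsto_pohozaev {α m p : ℝ} (hα : 0 < α) (hm : 0 < m) (hp : 1 < p)
    {y y' y'' : ℝ → ℝ} (h : DampedSol α m p y y' y'')
    (hJ : Tendsto (pohozaev m p y y') atBot (𝓝 0)) (hpos : ∀ᶠ t in atBot, 0 < y t) (t : ℝ) :
    0 < y t := by
  have hanti := h.antitone_pohozaev hα hm hp
  obtain ⟨T, hT⟩ := eventually_atBot.1 hpos
  by_contra! hcon
  obtain ⟨t₀, -, ht₀⟩ := intermediate_value_Icc' (min_le_right T t)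
    (fun x _ => (h.hasDerivAt x).continuousAt.continuousWithinAt)
    (show (0 : ℝ) ∈ Icc (y t) (y (min T t)) from ⟨hcon, (hT _ (min_le_left _ _)).le⟩)
  have hJ0 : 0 ≤ pohozaev m p y y' t₀ := by
    simp only [pohozaev, ht₀, Real.zero_rpow (show p + 1 ≠ 0 by linarith)]
    ring_nf
    positivity
  have hzero : ∀ s ≤ t₀, pohozaev m p y y' s = 0 := fun s hs =>
    le_antisymm (hanti.ge_of_tendsto hJ s) (hJ0.trans (hanti hs))
  set s := min T (t₀ - 1) with hs
  have hs0 : s < t₀ := (min_le_right _ _).trans_lt (by linarith)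
  have hev : pohozaev m p y y' =ᶠ[𝓝 s] fun _ => 0 := by
    filter_upwards [gt_mem_nhds hs0] with x hx using hzero x hx.le
  have hd := (h.hasDerivAt_pohozaev hp s).unique
    ((hasDerivAt_const s (0 : ℝ)).congr_of_eventuallyEq hev)
  have hys := hT s (min_le_left _ _)
  have h1 : 0 ≤ α * y' s ^ 2 := by positivity
  have h2 : 0 < m ^ 3 * exp (2 * m * s) * y s ^ 2 := by positivity
  linarith

/-- As long as `γ ^ (p - 1) s ^ 2` is small, the transformed solution grows exponentially. -/
lemma IsIVPSol.le_emdenDeriv {N : ℕ} (hN : 3 ≤ N) {p γ A m θ : ℝ} (hp : 1 < p) (hγ : 1 < γ)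
    (hA : 0 < A) (hm : 0 < m) (hθ : 0 < θ)
    {u u' u'' : ℝ → ℝ} (h : IsIVPSol N p γ u u' u'') (hpos : ∀ s > 0, 0 < u s) {t : ℝ}
    (ht : γ ^ (p - 1) * exp (m * t) ^ 2 ≤ θ * N / (θ + 2)) :
    m * θ / (2 * A) * γ * exp (m * θ * t) ≤ emdenDeriv A m θ u u' t := by
  set s := exp (m * t) with hs
  have hs0 : 0 < s := exp_pos _
  have hN0 : (0 : ℝ) < N := by exact_mod_cast (by omega : 0 < N)
  have hγp : γ ^ p = γ ^ (p - 1) * γ := by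
    rw [← Real.rpow_add_one (by linarith)]; congr 1; ring
  have h1 := mul_le_mul_of_nonneg_left (h.le_apply hN hp hγ hpos hs0) hθ.le
  have h2 := mul_le_mul_of_nonneg_left (h.neg_le_deriv hN hp hγ hpos hs0) hs0.le
  have h3 : θ * γ / 2 ≤ θ * u s + s * u' s := by
    have e : θ * (γ - γ ^ p * s ^ 2 / (2 * N)) + s * -(γ ^ p * s / N) =
        θ * γ - (γ ^ (p - 1) * s ^ 2) * (γ * (θ + 2) / (2 * N)) := by
      rw [hγp]; field_simp; ring
    have h4 := mul_le_mul_of_nonneg_right ht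
      (show 0 ≤ γ * (θ + 2) / (2 * N) by positivity)
    have e2 : θ * N / (θ + 2) * (γ * (θ + 2) / (2 * N)) = θ * γ / 2 := by field_simp
    linarith
  have h5 := mul_le_mul_of_nonneg_left h3
    (show 0 ≤ m * A⁻¹ * exp (m * θ * t) by positivity)
  simp only [emdenDeriv, ← hs]
  refine le_trans (le_of_eq ?_) h5
  field_simp

/-- The Pohozaev functional of solutions with large initial value is bounded away from `0`
far to the left. -/
lemma IsIVPSol.exists_pohozaev_le {N : ℕ} (hN : 3 ≤ N) {p A m θ : ℝ} (hp : 1 < p)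
    (hα : 0 < m * ((N : ℝ) - 2 - 2 * θ))
    (hA : 0 < A) (hm : 0 < m) (hθ : 0 < θ) (hθp : θ * (p - 1) = 2) :
    ∃ k₀ > 0, ∀ S, ∃ Γ, ∀ γ ≥ Γ, 1 < γ → ∀ u u' u'' : ℝ → ℝ, IsIVPSol N p γ u u' u'' →
      DampedSol (m * ((N : ℝ) - 2 - 2 * θ)) m p (emden A m θ u) (emdenDeriv A m θ u u')
        (emdenDeriv₂ A m θ u u' u'') → (∀ s > 0, 0 < u s) →
      pohozaev m p (emden A m θ u) (emdenDeriv A m θ u u') S ≤ -k₀ := by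
  set α := m * ((N : ℝ) - 2 - 2 * θ) with hαdef
  have hN0 : (0 : ℝ) < N := by exact_mod_cast (by omega : 0 < N)
  set b := θ * N / (θ + 2) with hb
  have hb0 : 0 < b := by positivity
  set k := α * (m * θ / (2 * A)) ^ 2 / (2 * (m * θ)) with hk
  have hk0 : 0 < k := by positivity
  refine ⟨k * exp (θ * log b), by positivity, fun S =>
    ⟨exp ((log b - 2 * m * S) / (p - 1)), fun γ hγ hγ1 u u' u'' h hy hpos => ?_⟩⟩
  have hγ0 : 0 < γ := by linarith
  set t₁ := (log b - (p - 1) * log γ) / (2 * m) with ht₁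
  have ht₁S : t₁ ≤ S := by
    have h1 := (Real.le_log_iff_exp_le hγ0).2 hγ
    rw [div_le_iff₀ (by linarith)] at h1
    rw [ht₁, div_le_iff₀ (by positivity)]
    linarith
  have hanti := hy.antitone_pohozaev hα hm hp
  refine (hanti ht₁S).trans ?_
  have h2mt : 2 * m * t₁ = log b - (p - 1) * log γ := by rw [ht₁]; field_simp
  have hgrow : ∀ t ≤ t₁, m * θ / (2 * A) * γ * exp (m * θ * t) ≤ emdenDeriv A m θ u u' t := by
    intro t ht
    apply h.le_emdenDeriv hN hp hγ1 hA hm hθ hpos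
    rw [Real.rpow_def_of_pos hγ0, ← Real.exp_nat_mul, ← exp_add, ← hb]
    conv_rhs => rw [← Real.exp_log hb0]
    apply exp_le_exp.2
    have := mul_le_mul_of_nonneg_left ht (show 0 ≤ 2 * m by positivity)
    push_cast
    linarith
  set F := fun t => pohozaev m p (emden A m θ u) (emdenDeriv A m θ u u') t +
    k * γ ^ 2 * exp (2 * (m * θ) * t) with hF
  have hFd : ∀ t, HasDerivAt F (-(α * emdenDeriv A m θ u u' t ^ 2) -
      m ^ 3 * exp (2 * m * t) * emden A m θ u t ^ 2 +
      k * γ ^ 2 * (2 * (m * θ) * exp (2 * (m * θ) * t))) t := fun t =>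
    (hy.hasDerivAt_pohozaev hp t).add ((hasDerivAt_exp_const_mul _ t).const_mul _)
  have hFanti : AntitoneOn F (Iic t₁) := by
    apply antitoneOn_of_deriv_nonpos (convex_Iic t₁)
    · exact fun t _ => (hFd t).continuousAt.continuousWithinAt
    · exact fun t _ => (hFd t).differentiableAt.differentiableWithinAt
    · intro t ht
      rw [interior_Iic] at ht
      rw [(hFd t).deriv]
      have h1 : (m * θ / (2 * A) * γ * exp (m * θ * t)) ^ 2 ≤ emdenDeriv A m θ u u' t ^ 2 :=
        pow_le_pow_left₀ (by positivity) (hgrow t (le_of_lt ht)) 2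
      have h2 := mul_le_mul_of_nonneg_left h1 hα.le
      have h3 : 0 ≤ m ^ 3 * exp (2 * m * t) * emden A m θ u t ^ 2 := by positivity
      have h4 : exp (2 * (m * θ) * t) = exp (m * θ * t) ^ 2 := by
        rw [← Real.exp_nat_mul]; congr 1; push_cast; ring
      have h5 : k * γ ^ 2 * (2 * (m * θ) * exp (2 * (m * θ) * t)) =
          α * (m * θ / (2 * A) * γ * exp (m * θ * t)) ^ 2 := by
        rw [h4, hk]; field_simp
      linarith
  have hFlim : Tendsto F atBot (𝓝 0) := by
    simpa using (h.tendsto_pohozaev (A := A) hp hm hθ).add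
      ((tendsto_exp_const_mul_atBot (show 0 < 2 * (m * θ) by positivity)).const_mul (k * γ ^ 2))
  have hF0 : F t₁ ≤ 0 := by
    apply ge_of_tendsto hFlim
    filter_upwards [eventually_le_atBot t₁] with t ht
    exact hFanti ht (mem_Iic.2 le_rfl) ht
  have hval : γ ^ 2 * exp (2 * (m * θ) * t₁) = exp (θ * log b) := by
    have e1 : γ ^ 2 = exp (2 * log γ) := by
      conv_lhs => rw [← Real.exp_log hγ0]
      rw [← Real.exp_nat_mul]; norm_num
    rw [e1, ← exp_add]
    congr 1
    linear_combination θ * h2mt - log γ * hθp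
  simp only [hF, mul_assoc k, hval] at hF0
  linarith


lemma derivs_eq_of_eq_mul_rpow_mul_comp_log {A m r : ℝ} {y y' y'' u u' u'' : ℝ → ℝ}
    (hy : ∀ t, HasDerivAt y (y' t) t) (hy' : ∀ t, HasDerivAt y' (y'' t) t)
    (hu : ∀ s > 0, HasDerivAt u (u' s) s) (hu' : ∀ s > 0, HasDerivAt u' (u'' s) s)
    (h : ∀ s > 0, u s = A * s ^ r * y (log s / m)) {s : ℝ} (hs : 0 < s) :
    u' s = A * s ^ (r - 1) * (r * y (log s / m) + y' (log s / m) / m) ∧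
    u'' s = A * s ^ (r - 1 - 1) * ((r - 1) * (r * y (log s / m) + y' (log s / m) / m) +
      (r * y' (log s / m) + y'' (log s / m) / m) / m) := by
  have h1 : ∀ s > 0, u' s = A * s ^ (r - 1) * (r * y (log s / m) + y' (log s / m) / m) := by
    intro s hs
    refine (hu s hs).unique
      ((hasDerivAt_mul_rpow_mul_comp_log A m r hs (hy _)).congr_of_eventuallyEq ?_)
    filter_upwards [lt_mem_nhds hs] with x hx using h x hx
  refine ⟨h1 s hs, (hu' s hs).unique ((hasDerivAt_mul_rpow_mul_comp_log A m (r - 1)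
    (g := fun t => r * y t + y' t / m) (g' := fun t => r * y' t + y'' t / m) hs
    (((hy _).const_mul r).add ((hy' _).div_const m))).congr_of_eventuallyEq ?_)⟩
  filter_upwards [lt_mem_nhds hs] with x hx using h1 x hx

lemma deriv_mul_rpow_mul_comp_log {A m r : ℝ} {y y' y'' : ℝ → ℝ}
    (hy : ∀ t, HasDerivAt y (y' t) t) (hy' : ∀ t, HasDerivAt y' (y'' t) t) {s : ℝ} (hs : 0 < s) :
    deriv (fun s => A * s ^ r * y (log s / m)) s =
      A * s ^ (r - 1) * (r * y (log s / m) + y' (log s / m) / m) ∧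
    deriv (deriv (fun s => A * s ^ r * y (log s / m))) s =
      A * s ^ (r - 1 - 1) * ((r - 1) * (r * y (log s / m) + y' (log s / m) / m) +
      (r * y' (log s / m) + y'' (log s / m) / m) / m) := by
  have h1 : ∀ s > 0, HasDerivAt (fun s => A * s ^ r * y (log s / m))
      (A * s ^ (r - 1) * (r * y (log s / m) + y' (log s / m) / m)) s := fun s hs =>
    hasDerivAt_mul_rpow_mul_comp_log A m r hs (hy _)
  have h2 : ∀ s > 0, HasDerivAt (deriv (fun s => A * s ^ r * y (log s / m)))
      (A * s ^ (r - 1 - 1) * ((r - 1) * (r * y (log s / m) + y' (log s / m) / m) +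
      (r * y' (log s / m) + y'' (log s / m) / m) / m)) s := fun s hs => by
    refine (hasDerivAt_mul_rpow_mul_comp_log A m (r - 1)
      (g := fun t => r * y t + y' t / m) (g' := fun t => r * y' t + y'' t / m) hs
      (((hy _).const_mul r).add ((hy' _).div_const m))).congr_of_eventuallyEq ?_
    filter_upwards [lt_mem_nhds hs] with x hx using (h1 x hx).deriv
  exact ⟨(h1 s hs).deriv, (h2 s hs).deriv⟩

lemma eq_mul_rpow_mul_emden {A m θ : ℝ} (hA : A ≠ 0) (hm : m ≠ 0) (u : ℝ → ℝ) {s : ℝ}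
    (hs : 0 < s) : u s = A * s ^ (-θ) * emden A m θ u (log s / m) := by
  have h1 : m * (log s / m) = log s := by field_simp
  have h2 : exp (m * θ * (log s / m)) = s ^ θ := by
    rw [Real.rpow_def_of_pos hs]; congr 1; field_simp
  rw [emden, h1, h2, Real.exp_log hs, Real.rpow_neg hs.le]
  have : s ^ θ ≠ 0 := (Real.rpow_pos_of_pos hs θ).ne'
  field_simp

/-- The algebraic relations among the constants of the problem. -/
lemma const_relations {N : ℕ} (hN : 3 ≤ N) {p : ℝ} (hp : 1 < p) (hpS : pSob N < p) :
    0 < thetaP p ∧ thetaP p * (p - 1) = 2 ∧ 0 < Aconst N p ∧ 0 < mConst N p ∧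
      0 < alphaConst N p ∧ mConst N p ^ 2 * (thetaP p * ((N : ℝ) - 2 - thetaP p)) = 1 ∧
      Aconst N p ^ (p - 1) * mConst N p ^ 2 = 1 := by
  have hN' : (3 : ℝ) ≤ N := by exact_mod_cast hN
  have hp1 : 0 < p - 1 := by linarith
  have hθ : 0 < thetaP p := by unfold thetaP; positivity
  have hθp : thetaP p * (p - 1) = 2 := by unfold thetaP; field_simp
  have h2θ : 0 < (N : ℝ) - 2 - 2 * thetaP p := by
    rw [pSob, div_lt_iff₀ (by linarith)] at hpS
    have : 2 * thetaP p * (p - 1) < ((N : ℝ) - 2) * (p - 1) := by nlinarith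
    linarith [lt_of_mul_lt_mul_right this hp1.le]
  have hX : 0 < thetaP p * ((N : ℝ) - 2 - thetaP p) := mul_pos hθ (by linarith)
  have hA : 0 < Aconst N p := Real.rpow_pos_of_pos hX _
  have hm : 0 < mConst N p := Real.rpow_pos_of_pos hX _
  have hm2 : mConst N p ^ 2 = (thetaP p * ((N : ℝ) - 2 - thetaP p))⁻¹ := by
    rw [mConst, ← Real.rpow_natCast, ← Real.rpow_mul hX.le, ← Real.rpow_neg_one]
    norm_num
  have hAp : Aconst N p ^ (p - 1) = thetaP p * ((N : ℝ) - 2 - thetaP p) := by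
    rw [Aconst, ← Real.rpow_mul hX.le, one_div, inv_mul_cancel₀ hp1.ne', Real.rpow_one]
  exact ⟨hθ, hθp, hA, hm, mul_pos hm h2θ, by rw [hm2, inv_mul_cancel₀ hX.ne'],
    by rw [hAp, hm2, mul_inv_cancel₀ hX.ne']⟩

lemma exists_abs_mul_rpow_le (A r a b : ℝ) (ha : 0 < a) :
    ∃ C > 0, ∀ s ∈ Icc a b, |A * s ^ r| ≤ C := by
  obtain ⟨C, hC⟩ := (isCompact_Icc (a := a) (b := b)).exists_bound_of_continuousOn
    (f := fun s : ℝ => A * s ^ r) (continuousOn_const.mul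
      (continuousOn_id.rpow_const fun s hs => Or.inl (ha.trans_le hs.1).ne'))
  exact ⟨max C 1, by positivity, fun s hs => (hC s hs).trans (le_max_left _ _)⟩

/-- `C²`-closeness is preserved by undoing the Emden–Fowler transform. -/
lemma abs_jet_sub_le {c₀ c₁ c₂ C m r δ w w' w'' : ℝ} (hm : 0 < m) (hC : 0 < C)
    (h₀ : |c₀| ≤ C) (h₁ : |c₁| ≤ C) (h₂ : |c₂| ≤ C)
    (hw : |w| ≤ δ) (hw' : |w'| ≤ δ) (hw'' : |w''| ≤ δ) :
    |c₀ * w| + |c₁ * (r * w + w' / m)| +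
      |c₂ * ((r - 1) * (r * w + w' / m) + (r * w' + w'' / m) / m)| ≤
      C * (1 + (|r| + 1 / m) + (|r - 1| * (|r| + 1 / m) + (|r| + 1 / m) / m)) * δ := by
  have hδ : 0 ≤ δ := (abs_nonneg _).trans hw
  have key : ∀ x z : ℝ, |x| ≤ δ → |z| ≤ δ → |r * x + z / m| ≤ (|r| + 1 / m) * δ := by
    intro x z hx hz
    refine (abs_add_le _ _).trans ?_
    rw [abs_mul, abs_div, abs_of_pos hm]
    have h1 := mul_le_mul_of_nonneg_left hx (abs_nonneg r)
    have h2 := div_le_div_of_nonneg_right hz hm.le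
    have h3 : δ / m = 1 / m * δ := by ring
    linarith
  have k1 := key w w' hw hw'
  have k2 := key w' w'' hw' hw''
  have k3 : |(r - 1) * (r * w + w' / m) + (r * w' + w'' / m) / m| ≤
      (|r - 1| * (|r| + 1 / m) + (|r| + 1 / m) / m) * δ := by
    refine (abs_add_le _ _).trans ?_
    rw [abs_mul, abs_div _ m, abs_of_pos hm]
    have h1 := mul_le_mul_of_nonneg_left k1 (abs_nonneg (r - 1))
    have h2 := div_le_div_of_nonneg_right k2 hm.le
    have h3 : (|r| + 1 / m) * δ / m = (|r| + 1 / m) / m * δ := by ring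
    linarith
  have e0 : |c₀ * w| ≤ C * δ := by
    rw [abs_mul]; exact mul_le_mul h₀ hw (abs_nonneg _) hC.le
  have e1 : |c₁ * (r * w + w' / m)| ≤ C * ((|r| + 1 / m) * δ) := by
    rw [abs_mul]; exact mul_le_mul h₁ k1 (abs_nonneg _) hC.le
  have e2 : |c₂ * ((r - 1) * (r * w + w' / m) + (r * w' + w'' / m) / m)| ≤
      C * ((|r - 1| * (|r| + 1 / m) + (|r| + 1 / m) / m) * δ) := by
    rw [abs_mul]; exact mul_le_mul h₂ k3 (abs_nonneg _) hC.le
  linarith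


/-- Theorem 5.1: as `γ → ∞`, `u(·,γ)` converges to the singular
solution `u*` in `C²` uniformly on compact subsets of `(0,∞)`. -/
theorem convergence_to_singular_solution (N : ℕ) (hN : 3 ≤ N) (p : ℝ) (hp : 1 < p)
    (hpS : pSob N < p)
    (ys ys' ys'' : ℝ → ℝ) (hys : IsEntireSingODE N p ys ys' ys'')
    (U U' U'' : ℝ → ℝ → ℝ)
    (hU : ∀ γ > (1:ℝ), IsIVPSol N p γ (U γ) (U' γ) (U'' γ)) :
    ∀ a b : ℝ, 0 < a → a ≤ b → ∀ ε > (0:ℝ), ∃ Γ : ℝ, ∀ γ ≥ Γ, ∀ s ∈ Icc a b,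
      |U γ s - ustar N p ys s| + |U' γ s - deriv (ustar N p ys) s|
        + |U'' γ s - deriv (deriv (ustar N p ys)) s| < ε := by
  intro a b ha hab ε hε
  obtain ⟨hθ, hθp, hA, hm, hα, hmθ, hAm⟩ := const_relations hN hp hpS
  have hz : DampedSol (alphaConst N p) (mConst N p) p ys ys' ys'' := ⟨hys.1, hys.2.1, hys.2.2.2.1⟩
  obtain ⟨k₀, hk₀, hk⟩ := IsIVPSol.exists_pohozaev_le hN hp hα hA hm hθ hθp
  set r := -thetaP p with hr
  obtain ⟨C₀, hC₀, hb₀⟩ := exists_abs_mul_rpow_le (Aconst N p) r a b ha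
  obtain ⟨C₁, hC₁, hb₁⟩ := exists_abs_mul_rpow_le (Aconst N p) (r - 1) a b ha
  obtain ⟨C₂, hC₂, hb₂⟩ := exists_abs_mul_rpow_le (Aconst N p) (r - 1 - 1) a b ha
  obtain ⟨C, hC, hCle₀, hCle₁, hCle₂⟩ : ∃ C > 0, C₀ ≤ C ∧ C₁ ≤ C ∧ C₂ ≤ C :=
    ⟨C₀ + C₁ + C₂, by positivity, by linarith, by linarith, by linarith⟩
  set W := C * (1 + (|r| + 1 / mConst N p) +
    (|r - 1| * (|r| + 1 / mConst N p) + (|r| + 1 / mConst N p) / mConst N p)) with hW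
  have hW0 : 0 < W := by positivity
  obtain ⟨S, hS⟩ := exists_forall_abs_sub_le hα hm hp hz hys.2.2.2.2 hk₀
    (show 0 < ε / (2 * W) by positivity) (log a / mConst N p) (log b / mConst N p)
  obtain ⟨Γ, hΓ⟩ := hk S
  refine ⟨max Γ 2, fun γ hγ s hs => ?_⟩
  have hγ1 : 1 < γ := by linarith [le_max_right Γ 2]
  have hu := hU γ hγ1
  have hy := dampedSol_emden hA hmθ hAm hθp (fun s hs => hu.hasDerivAt hs)
    (fun s hs => hu.hasDerivAt' hs) (fun s hs => hu.ode hs)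
  have hypos := hy.pos_of_tendsto_pohozaev hα hm hp (hu.tendsto_pohozaev hp hm hθ)
    (hu.eventually_emden_pos (by linarith) hA hm)
  have hyJ := (hy.antitone_pohozaev hα hm hp).ge_of_tendsto (hu.tendsto_pohozaev hp hm hθ)
  have hueq : ∀ s > 0, U γ s = Aconst N p * s ^ r *
      emden (Aconst N p) (mConst N p) (thetaP p) (U γ) (log s / mConst N p) := fun s hs =>
    eq_mul_rpow_mul_emden hA.ne' hm.ne' (U γ) hs
  have hupos : ∀ s > 0, 0 < U γ s := fun s hs => by
    rw [hueq s hs]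
    have := hypos (log s / mConst N p)
    positivity
  have hs0 : 0 < s := ha.trans_le hs.1
  obtain ⟨hw, hw', hw''⟩ := hS _ _ _ hy hypos hyJ
    (hΓ γ ((le_max_left _ _).trans hγ) hγ1 _ _ _ hu hy hupos) (log s / mConst N p)
    ⟨div_le_div_of_nonneg_right (Real.log_le_log ha hs.1) hm.le,
      div_le_div_of_nonneg_right (Real.log_le_log hs0 hs.2) hm.le⟩
  have hfinal := abs_jet_sub_le (r := r) hm hC ((hb₀ s hs).trans hCle₀)
    ((hb₁ s hs).trans hCle₁) ((hb₂ s hs).trans hCle₂) hw hw' hw''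
  obtain ⟨hu1, hu2⟩ := derivs_eq_of_eq_mul_rpow_mul_comp_log hy.hasDerivAt hy.hasDerivAt'
    (fun s hs => hu.hasDerivAt hs) (fun s hs => hu.hasDerivAt' hs) hueq hs0
  obtain ⟨hz1, hz2⟩ := deriv_mul_rpow_mul_comp_log (A := Aconst N p) (m := mConst N p) (r := r)
    hz.hasDerivAt hz.hasDerivAt' hs0
  have hstar : ustar N p ys = fun s => Aconst N p * s ^ r * ys (log s / mConst N p) := rfl
  rw [hstar, hz1, hz2, hueq s hs0, hu1, hu2]
  refine lt_of_le_of_lt (le_of_eq ?_) (hfinal.trans_lt ?_)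
  · congr 1
    · congr 1
      · congr 1; ring
      · congr 1; ring
    · congr 1; ring
  · rw [← hW]
    have : W * (ε / (2 * W)) = ε / 2 := by field_simp
    linarith
end
end
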